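/- arXiv:math/0701158 — 2 statements merged into one kernel-verified Lean document; each statement's English description precedes it below -/
import Mathlib

section
/- Let p ∈ [1,∞) and let (λ_n)_{n∈ℤ} be a strictly increasing sequence of real numbers with λ_n = π(n+1/2) + e_n(g) for some g ∈ L_p(0,1). Then the system (v_n)_{n∈ℤ}, where v_n(x) := (cos λ_n x, sin λ_n x)ᵗ, forms a Riesz basis of ℍ = L₂((0,1),ℂ²): the map (a_n) ↦ Σ_{n∈ℤ} a_n v_n is a well-defined, bounded, bijective linear operator from ℓ²(ℤ) onto ℍ with bounded inverse. -/
open MeasureTheory Complex Filter Set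
open scoped Matrix.Norms.L2Operator ENNReal

noncomputable section

abbrev M2 := Matrix (Fin 2) (Fin 2) ℂ

def Bmat : M2 := !![0, 1; -1, 0]

def Jmat : M2 := !![1, 0; 0, -1]

/-- `expB τ = e^{-τ B} = [[cos τ, -sin τ],[sin τ, cos τ]]`. -/
def expB (τ : ℂ) : M2 := !![Complex.cos τ, -Complex.sin τ; Complex.sin τ, Complex.cos τ]

/-- Lebesgue measure restricted to `(0,1)`. -/
def μ01 : Measure ℝ := volume.restrict (Set.Ioo 0 1)

/-- Lebesgue measure restricted to `(-1,1)`. -/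
def μ11 : Measure ℝ := volume.restrict (Set.Ioo (-1) 1)

/-- A Dirac-form potential `Q = [[q₁,q₂],[q₂,-q₁]]`. -/
def IsDiracForm (Q : ℝ → M2) : Prop :=
  ∃ q1 q2 : ℝ → ℂ, ∀ x, Q x = !![q1 x, q2 x; q2 x, -q1 x]

/-- A Dirac-form potential with real-valued entries. -/
def IsRealDiracForm (Q : ℝ → M2) : Prop :=
  ∃ q1 q2 : ℝ → ℝ, ∀ x, Q x = !![(q1 x : ℂ), (q2 x : ℂ); (q2 x : ℂ), -(q1 x : ℂ)]

/-- `U` is an absolutely continuous matrix solution of `B U' + Q U = λ U` a.e. on `(0,1)`. -/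
def IsMatSolution (Q : ℝ → M2) (l : ℂ) (U : ℝ → M2) : Prop :=
  ∃ U' : ℝ → M2, IntegrableOn U' (Set.Ioo 0 1) ∧
    (∀ x ∈ Set.Icc (0:ℝ) 1, U x = U 0 + ∫ t in (0:ℝ)..x, U' t) ∧
    (∀ᵐ x ∂μ01, Bmat * U' x + Q x * U x = l • U x)

/-- `u` is an absolutely continuous `ℂ²`-valued solution of `B u' + Q u = λ u` a.e. on `(0,1)`. -/
def IsVecSolution (Q : ℝ → M2) (l : ℂ) (u : ℝ → Fin 2 → ℂ) : Prop :=
  ∃ u' : ℝ → Fin 2 → ℂ, IntegrableOn u' (Set.Ioo 0 1) ∧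
    (∀ x ∈ Set.Icc (0:ℝ) 1, u x = u 0 + ∫ t in (0:ℝ)..x, u' t) ∧
    (∀ᵐ x ∂μ01, Bmat.mulVec (u' x) + (Q x).mulVec (u x) = l • u x)

/-- `λ` is an eigenvalue of the Dirac operator `A_j` (`j = 0` for `A₁`, `j = 1` for `A₂`):
there is a nonzero AC solution with `u₂(0) = 0` and `u_j(1) = 0`. -/
def IsEigenvalue (Q : ℝ → M2) (j : Fin 2) (l : ℝ) : Prop :=
  ∃ u : ℝ → Fin 2 → ℂ, IsVecSolution Q (l : ℂ) u ∧
    (∃ x ∈ Set.Icc (0:ℝ) 1, u x ≠ 0) ∧ u 0 1 = 0 ∧ u 1 j = 0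

/-- `c₀(·,λ) = (cos λx, sin λx)ᵗ`. -/
def c0 (l : ℂ) (x : ℝ) : Fin 2 → ℂ := ![Complex.cos (l * x), Complex.sin (l * x)]

/-- n-th Fourier coefficient `e_n(g) = ∫₀¹ e^{-2πinx} g(x) dx`. -/
def fc (g : ℝ → ℂ) (n : ℤ) : ℂ :=
  ∫ x in (0:ℝ)..1, Complex.exp (-2 * Real.pi * Complex.I * n * x) * g x

/-- The square of the `ℍ = L₂((0,1),ℂ²)` norm of `u`. -/
def hnormSq (u : ℝ → Fin 2 → ℂ) : ℝ :=
  ∫ x in Set.Ioo (0:ℝ) 1, (‖u x 0‖ ^ 2 + ‖u x 1‖ ^ 2)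

/-- The `ℂ²` inner product `⟨v,w⟩ = v₁ w̄₁ + v₂ w̄₂`. -/
def ip2 (v w : Fin 2 → ℂ) : ℂ := v 0 * star (w 0) + v 1 * star (w 1)

/-- The eigenvalue asymptotics `λ_n = π(n+1/2) + e_n(g)` for some `g ∈ L_p(0,1)`. -/
def LamAsymp (p : ℝ≥0∞) (lam : ℤ → ℝ) : Prop :=
  ∃ g : ℝ → ℂ, MemLp g p μ01 ∧
    ∀ n : ℤ, (lam n : ℂ) = Real.pi * (n + 1/2) + fc g n

/-- The eigenvalue asymptotics `μ_n = πn + e_n(g)` for some `g ∈ L_p(0,1)`. -/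
def MuAsymp (p : ℝ≥0∞) (mu : ℤ → ℝ) : Prop :=
  ∃ g : ℝ → ℂ, MemLp g p μ01 ∧
    ∀ n : ℤ, (mu n : ℂ) = Real.pi * n + fc g n

/-- The norming-constant asymptotics `α_n = 1 + e_n(g)` for some `g ∈ L_p(0,1)`. -/
def AlAsymp (p : ℝ≥0∞) (al : ℤ → ℝ) : Prop :=
  ∃ g : ℝ → ℂ, MemLp g p μ01 ∧ ∀ n : ℤ, (al n : ℂ) = 1 + fc g n

/-- Membership in the class `SD_p` of spectral data. -/
def MemSD (p : ℝ≥0∞) (lam mu : ℤ → ℝ) : Prop :=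
  (∀ n : ℤ, lam (n - 1) < mu n ∧ mu n < lam n) ∧ LamAsymp p lam ∧ MuAsymp p mu

/-- Membership in the kernel space `G_p(M₂)`: all slices lie in `L_p` and the slice maps are
continuous from `[0,1]` to `L_p((0,1),M₂)`. -/
def MemGp (p : ℝ≥0∞) (K : ℝ → ℝ → M2) : Prop :=
  (∀ x ∈ Set.Icc (0:ℝ) 1, MemLp (K x) p μ01) ∧
  (∀ t ∈ Set.Icc (0:ℝ) 1, MemLp (fun x => K x t) p μ01) ∧
  (∀ x₀ ∈ Set.Icc (0:ℝ) 1, ∀ ε > (0:ℝ), ∃ δ > (0:ℝ), ∀ x ∈ Set.Icc (0:ℝ) 1,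
    |x - x₀| < δ → eLpNorm (fun t => K x t - K x₀ t) p μ01 < ENNReal.ofReal ε) ∧
  (∀ t₀ ∈ Set.Icc (0:ℝ) 1, ∀ ε > (0:ℝ), ∃ δ > (0:ℝ), ∀ t ∈ Set.Icc (0:ℝ) 1,
    |t - t₀| < δ → eLpNorm (fun x => K x t - K x t₀) p μ01 < ENNReal.ofReal ε)

/-- The norm of the space `G_p(M₂)` (as an extended real number). -/
def gpNorm (p : ℝ≥0∞) (K : ℝ → ℝ → M2) : ℝ≥0∞ :=
  max (⨆ x ∈ Set.Icc (0:ℝ) 1, eLpNorm (K x) p μ01)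
      (⨆ t ∈ Set.Icc (0:ℝ) 1, eLpNorm (fun x => K x t) p μ01)




namespace RB

abbrev W := EuclideanSpace ℂ (Fin 2)
abbrev HH := Lp W 2 μ01

instance : IsProbabilityMeasure μ01 := ⟨by simp [μ01]⟩

/-- The vector of `ℂ²` with the coordinates `α, β` in the eigenbasis of the rotation. -/
def pt (α β : ℂ) : W := WithLp.toLp 2 ![(α + β) / 2, -(I * (α - β)) / 2]

lemma pt_zero (α β : ℂ) : pt α β 0 = (α + β) / 2 := rfl
lemma pt_one (α β : ℂ) : pt α β 1 = -(I * (α - β)) / 2 := rfl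

lemma pt_add (α β γ δ : ℂ) : pt α β + pt γ δ = pt (α + γ) (β + δ) := by
  ext i; fin_cases i
  · simp [pt_zero]; ring
  · simp [pt_one]; ring

lemma pt_sub (α β γ δ : ℂ) : pt α β - pt γ δ = pt (α - γ) (β - δ) := by
  ext i; fin_cases i
  · simp [pt_zero]; ring
  · simp [pt_one]; ring

lemma pt_smul (c α β : ℂ) : c • pt α β = pt (c * α) (c * β) := by
  ext i; fin_cases i
  · simp [pt_zero]; ring
  · simp [pt_one]; ring

lemma pt_nil : pt 0 0 = 0 := by
  ext i; fin_cases i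
  · simp [pt_zero]
  · simp [pt_one]

lemma pt_sum {ι : Type*} (s : Finset ι) (α β : ι → ℂ) :
    ∑ i ∈ s, pt (α i) (β i) = pt (∑ i ∈ s, α i) (∑ i ∈ s, β i) := by
  classical
  induction s using Finset.induction_on with
  | empty => simp [pt_nil]
  | insert a s ha ih => rw [Finset.sum_insert ha, Finset.sum_insert ha, Finset.sum_insert ha, ih, pt_add]

lemma inner_pt (α β γ δ : ℂ) :
    inner ℂ (pt α β) (pt γ δ) = (star α * γ + star β * δ) / 2 := by
  simp only [PiLp.inner_apply, Fin.sum_univ_two, pt_zero, pt_one, RCLike.inner_apply]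
  have h2 : (starRingEnd ℂ) 2 = 2 := Complex.conj_ofNat 2
  simp only [map_div₀, map_add, map_neg, map_mul, map_sub, conj_I, h2, star_def]
  linear_combination ((starRingEnd ℂ) α - (starRingEnd ℂ) β) * (γ - δ) / (-4) * I_sq

lemma norm_pt_sq (α β : ℂ) : ‖pt α β‖ ^ 2 = (‖α‖ ^ 2 + ‖β‖ ^ 2) / 2 := by
  have h := inner_self_eq_norm_sq_to_K (𝕜 := ℂ) (pt α β)
  rw [inner_pt] at h
  have e : ∀ z : ℂ, star z * z = ((‖z‖ ^ 2 : ℝ) : ℂ) := fun z => by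
    have := Complex.conj_mul' z
    simpa using this
  rw [e, e] at h
  have : ((‖pt α β‖ ^ 2 : ℝ) : ℂ) = (((‖α‖ ^ 2 + ‖β‖ ^ 2) / 2 : ℝ) : ℂ) := by
    push_cast at h ⊢
    exact h.symm
  exact_mod_cast this

lemma norm_pt_le {α β γ δ : ℂ} (h1 : ‖α‖ ≤ ‖γ‖) (h2 : ‖β‖ ≤ ‖δ‖) : ‖pt α β‖ ≤ ‖pt γ δ‖ := by
  apply le_of_sq_le_sq _ (norm_nonneg _)
  rw [norm_pt_sq, norm_pt_sq]
  gcongr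

lemma norm_pt_le_const {α β : ℂ} {C : ℝ} (h1 : ‖α‖ ≤ C) (h2 : ‖β‖ ≤ C) : ‖pt α β‖ ≤ C := by
  have hC : 0 ≤ C := (norm_nonneg _).trans h1
  apply le_of_sq_le_sq _ hC
  rw [norm_pt_sq]
  have := pow_le_pow_left₀ (norm_nonneg _) h1 2
  have := pow_le_pow_left₀ (norm_nonneg _) h2 2
  linarith

lemma eq_pt (v : W) : v = pt (v 0 + I * v 1) (v 0 - I * v 1) := by
  ext i; fin_cases i
  · simp [pt_zero]
  · simp only [Fin.mk_one, pt_one]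
    ring_nf
    simp

lemma continuous_pt : Continuous (fun z : ℂ × ℂ => pt z.1 z.2) := by
  unfold pt
  apply (PiLp.continuous_toLp 2 _).comp
  apply continuous_pi
  intro i
  fin_cases i
  · simp; fun_prop
  · simp; fun_prop

/-- Taylor coefficients of the exponentials. -/
def wf (k : ℕ) (l : ℝ) (x : ℝ) : W :=
  pt ((I * x) ^ k * exp (I * l * x)) ((-I * x) ^ k * exp (-I * l * x))

lemma wf_zero (l : ℝ) (x : ℝ) :
    wf 0 l x = (WithLp.equiv 2 (Fin 2 → ℂ)).symm (c0 (l : ℂ) x) := by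
  ext i; fin_cases i
  · simp only [wf, c0, Complex.cos]
    simp [pt_zero]
    ring_nf
  · simp only [wf, c0, Complex.sin]
    simp [pt_one]
    ring_nf

lemma norm_exp_I (l x : ℝ) : ‖exp (I * l * x)‖ = 1 := by
  have : I * l * x = ((l * x : ℝ) : ℂ) * I := by push_cast; ring
  rw [this, norm_exp_ofReal_mul_I]

lemma norm_exp_neg_I (l x : ℝ) : ‖exp (-I * l * x)‖ = 1 := by
  have := norm_exp_I (-l) x
  push_cast at this
  rw [← this]; ring_nf

lemma continuous_wf (k : ℕ) (l : ℝ) : Continuous (wf k l) := by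
  unfold wf
  exact continuous_pt.comp (f := fun x : ℝ => (((I * x) ^ k * exp (I * l * x)), ((-I * x) ^ k * exp (-I * l * x)))) (by fun_prop)

lemma ae_mem : ∀ᵐ x ∂μ01, x ∈ Ioo (0:ℝ) 1 := ae_restrict_mem measurableSet_Ioo

lemma memLp_wf (k : ℕ) (l : ℝ) : MemLp (wf k l) 2 μ01 := by
  apply MemLp.of_bound (continuous_wf k l).aestronglyMeasurable 1
  filter_upwards [ae_mem] with x hx
  have hx1 : ‖(x:ℂ)‖ ≤ 1 := by
    rw [norm_real, Real.norm_of_nonneg hx.1.le]; exact hx.2.le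
  apply norm_pt_le_const
  · rw [norm_mul, norm_exp_I, norm_pow, norm_mul, norm_I, one_mul, mul_one]
    exact pow_le_one₀ (norm_nonneg _) hx1
  · rw [norm_mul, norm_exp_neg_I, norm_pow, norm_mul, norm_neg, norm_I, one_mul, mul_one]
    exact pow_le_one₀ (norm_nonneg _) hx1

def w (k : ℕ) (l : ℝ) : HH := (memLp_wf k l).toLp

lemma coe_w (k : ℕ) (l : ℝ) : w k l =ᵐ[μ01] wf k l := MemLp.coeFn_toLp _

lemma coe_sum {ι : Type*} (s : Finset ι) (f : ι → HH) (g : ι → ℝ → W)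
    (h : ∀ i, f i =ᵐ[μ01] g i) : (∑ i ∈ s, f i : HH) =ᵐ[μ01] fun x => ∑ i ∈ s, g i x := by
  classical
  induction s using Finset.induction_on with
  | empty => simpa using! Lp.coeFn_zero W 2 μ01
  | insert a s ha ih =>
    rw [Finset.sum_insert ha]
    filter_upwards [Lp.coeFn_add (f a) (∑ i ∈ s, f i), ih, h a] with x h1 h2 h3
    rw [h1, Pi.add_apply, h2, h3, Finset.sum_insert ha]

lemma coe_smul_of {f : HH} {g : ℝ → W} (c : ℂ) (h : f =ᵐ[μ01] g) :
    (c • f : HH) =ᵐ[μ01] fun x => c • g x := by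
  filter_upwards [Lp.coeFn_smul c f, h] with x h1 h2
  rw [h1, Pi.smul_apply, h2]

lemma norm_sum_w_le (k : ℕ) (s : Finset ℤ) (b : ℤ → ℂ) (l : ℤ → ℝ) :
    ‖∑ n ∈ s, b n • w k (l n)‖ ≤ ‖∑ n ∈ s, b n • w 0 (l n)‖ := by
  apply Lp.norm_le_norm_of_ae_le
  filter_upwards [coe_sum s _ _ (fun n => coe_smul_of (b n) (coe_w k (l n))),
    coe_sum s _ _ (fun n => coe_smul_of (b n) (coe_w 0 (l n))), ae_mem] with x h1 h2 hx
  have hx1 : ‖(x:ℂ)‖ ≤ 1 := by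
    rw [norm_real, Real.norm_of_nonneg hx.1.le]; exact hx.2.le
  rw [h1, h2]
  simp only [wf, pt_smul, pt_sum]
  have e : ∀ z : ℂ, ∀ f : ℤ → ℂ, ∑ n ∈ s, b n * (z ^ k * f n) = z ^ k * ∑ n ∈ s, b n * f n := by
    intro z f
    rw [Finset.mul_sum]
    exact Finset.sum_congr rfl fun n _ => by ring
  rw [e, e]
  apply norm_pt_le
  · rw [norm_mul, norm_pow, norm_mul, norm_I, one_mul]
    simp only [pow_zero, one_mul]
    exact mul_le_of_le_one_left (norm_nonneg _) (pow_le_one₀ (norm_nonneg _) hx1)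
  · rw [norm_mul, norm_pow, norm_mul, norm_neg, norm_I, one_mul]
    simp only [pow_zero, one_mul]
    exact mul_le_of_le_one_left (norm_nonneg _) (pow_le_one₀ (norm_nonneg _) hx1)

lemma norm_taylor (l d : ℝ) (K : ℕ) :
    ‖w 0 (l + d) - ∑ k ∈ Finset.range K, ((d : ℂ) ^ k / (k.factorial : ℂ)) • w k l‖
      ≤ |d| ^ K * Real.exp |d| := by
  have hC : 0 ≤ |d| ^ K * Real.exp |d| := by positivity
  have := Lp.norm_le_of_ae_bound (p := 2) (μ := μ01)
    (f := w 0 (l + d) - ∑ k ∈ Finset.range K, ((d : ℂ) ^ k / (k.factorial : ℂ)) • w k l) hC ?_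
  · have hm : measureUnivNNReal μ01 = 1 := by simp [measureUnivNNReal]
    simpa [hm] using this
  filter_upwards [coe_sum (Finset.range K) _ _
    (fun k => coe_smul_of ((d : ℂ) ^ k / (k.factorial : ℂ)) (coe_w k l)), ae_mem, coe_w 0 (l + d),
    Lp.coeFn_sub (w 0 (l + d)) (∑ k ∈ Finset.range K, ((d : ℂ) ^ k / (k.factorial : ℂ)) • w k l)]
    with x h1 hx h2 h3
  rw [h3, Pi.sub_apply, h1, h2]
  simp only [wf, pt_smul, pt_sum, pt_sub]
  have hx1 : |x| ≤ 1 := by rw [abs_of_pos hx.1]; exact hx.2.le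
  have key : ∀ z : ℂ, ‖z‖ ≤ 1 → ∀ e : ℂ, ‖e‖ = 1 → ∀ e', e' = e * exp (d * z) →
      ‖e' - ∑ k ∈ Finset.range K, (d:ℂ) ^ k / (k.factorial : ℂ) * (z ^ k * e)‖
        ≤ |d| ^ K * Real.exp |d| := by
    intro z hz e he e' he'
    have hs : e' - ∑ k ∈ Finset.range K, (d:ℂ) ^ k / (k.factorial : ℂ) * (z ^ k * e)
        = e * (exp (d * z) - ∑ k ∈ Finset.range K, (d * z) ^ k / (k.factorial : ℂ)) := by
      rw [he', mul_sub, Finset.mul_sum]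
      congr 1
      exact Finset.sum_congr rfl fun k _ => by rw [mul_pow]; ring
    rw [hs, norm_mul, he, one_mul]
    refine (norm_exp_sub_sum_le_norm_mul_exp _ _).trans ?_
    have : ‖(d:ℂ) * z‖ ≤ |d| := by
      rw [norm_mul, norm_real, Real.norm_eq_abs]
      exact mul_le_of_le_one_right (abs_nonneg _) hz
    gcongr
  apply norm_pt_le_const
  · apply key (I * x) (by simpa using hx1) _ (norm_exp_I l x)
    rw [← Complex.exp_add]
    simp only [pow_zero, one_mul]
    congr 1; push_cast; ring
  · apply key (-I * x) (by simpa using hx1) _ (norm_exp_neg_I l x)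
    rw [← Complex.exp_add]
    simp only [pow_zero, one_mul]
    congr 1; push_cast; ring


lemma inner_w (z : ℝ) (f : HH) (a b : ℝ → ℂ) (h : f =ᵐ[μ01] fun x => pt (a x) (b x)) :
    inner ℂ (w 0 z) f = ∫ x, (exp (-I * z * x) * a x + exp (I * z * x) * b x) / 2 ∂μ01 := by
  rw [L2.inner_def]
  apply integral_congr_ae
  filter_upwards [h, coe_w 0 z] with x h1 h2
  rw [h1, h2, wf, inner_pt]
  simp only [pow_zero, one_mul]
  congr 3
  · rw [star_def, ← exp_conj]; simp
  · rw [star_def, ← exp_conj]; simp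

lemma integral_μ01 (f : ℝ → ℂ) : ∫ x, f x ∂μ01 = ∫ x in (0:ℝ)..1, f x := by
  rw [intervalIntegral.integral_of_le zero_le_one, μ01, integral_Ioc_eq_integral_Ioo]

def nu (n : ℤ) : ℝ := Real.pi * (n + 1 / 2)

lemma inner_w_w (l m : ℝ) :
    inner ℂ (w 0 l) (w 0 m) = ∫ x in (0:ℝ)..1, Complex.cos (((m - l : ℝ) : ℂ) * x) := by
  rw [inner_w l (w 0 m) (fun x => exp (I * m * x)) (fun x => exp (-I * m * x)), integral_μ01]
  · congr 1
    ext x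
    rw [← Complex.exp_add, ← Complex.exp_add, Complex.cos]
    congr 3
    · push_cast; ring
    · push_cast; ring
  · filter_upwards [coe_w 0 m] with x hx
    rw [hx, wf]; simp

lemma orthonormal_w : Orthonormal ℂ (fun n : ℤ => w 0 (nu n)) := by
  rw [orthonormal_iff_ite]
  intro i j
  rw [inner_w_w]
  split_ifs with h
  · subst h; simp
  · have e : nu j - nu i = ((j - i : ℤ) : ℝ) * Real.pi := by
      simp only [nu]; push_cast; ring
    have hne : ((nu j - nu i : ℝ) : ℂ) ≠ 0 := by
      rw [e]
      have : j - i ≠ 0 := sub_ne_zero.2 (Ne.symm h)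
      exact_mod_cast mul_ne_zero (Int.cast_ne_zero.2 this) Real.pi_ne_zero
    rw [integral_cos_mul_complex hne]
    rw [e]
    have : Complex.sin ((((j - i : ℤ) : ℝ) * Real.pi : ℝ) * (1:ℝ)) = 0 := by
      have := Complex.sin_int_mul_pi (j - i)
      simpa using this
    rw [this]
    simp

lemma memLp_coords (f : HH) : MemLp (fun x => (f : ℝ → W) x 0 + I * (f : ℝ → W) x 1) 2 μ01 ∧
    MemLp (fun x => (f : ℝ → W) x 0 - I * (f : ℝ → W) x 1) 2 μ01 := by
  have hf := Lp.memLp f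
  have h : ∀ i, MemLp (fun x => (f : ℝ → W) x i) 2 μ01 := fun i =>
    hf.of_le (((EuclideanSpace.proj i : W →L[ℂ] ℂ).continuous).comp_aestronglyMeasurable hf.1)
      (Eventually.of_forall fun x => PiLp.norm_apply_le _ _)
  exact ⟨(h 0).add ((h 1).const_mul I), (h 0).sub ((h 1).const_mul I)⟩

lemma complete_fourier {a b : ℝ → ℂ} (ha : MemLp a 2 μ01) (hb : MemLp b 2 μ01)
    (h : ∀ n : ℤ, ∫ x, (exp (-I * nu n * x) * a x + exp (I * nu n * x) * b x) / 2 ∂μ01 = 0) :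
    a =ᵐ[μ01] 0 ∧ b =ᵐ[μ01] 0 := by
  set A : ℝ → ℂ := (Ioo (0:ℝ) 1).indicator a with hA
  set B : ℝ → ℂ := (Ioo (0:ℝ) 1).indicator b with hB
  have hAm : MemLp A 2 volume := (memLp_indicator_iff_restrict measurableSet_Ioo).2 ha
  have hBm : MemLp B 2 volume := (memLp_indicator_iff_restrict measurableSet_Ioo).2 hb
  have hA1 : Integrable A := (integrable_indicator_iff measurableSet_Ioo).2 (ha.integrable one_le_two)
  have hB1 : Integrable B := (integrable_indicator_iff measurableSet_Ioo).2 (hb.integrable one_le_two)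
  have hBn : MemLp (fun x => B (-x)) 2 volume :=
    hBm.comp_measurePreserving (Measure.measurePreserving_neg volume)
  set ψ : ℝ → ℂ := fun x => exp (((-(Real.pi / 2) * x : ℝ) : ℂ) * I) * (A x + B (-x)) with hψ
  have hnorm : ∀ x, ‖ψ x‖ = ‖A x + B (-x)‖ := fun x => by
    simp only [hψ]; rw [norm_mul, norm_exp_ofReal_mul_I, one_mul]
  have hψm : MemLp ψ 2 volume := by
    refine (hAm.add hBn).of_le ?_ (Eventually.of_forall fun x => (hnorm x).le)
    refine AEStronglyMeasurable.mul ?_ (hAm.add hBn).1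
    exact Continuous.aestronglyMeasurable (by fun_prop)
  have hsupp : ∀ x, x ∉ Ioc (-1:ℝ) 1 → A x + B (-x) = 0 := by
    intro x hx
    have h1 : x ∉ Ioo (0:ℝ) 1 := fun h => hx ⟨by linarith [h.1], h.2.le⟩
    have h2 : -x ∉ Ioo (0:ℝ) 1 := fun h => hx ⟨by linarith [h.2], by linarith [h.1]⟩
    simp [hA, hB, h1, h2]
  have hlt : (-1:ℝ) < 1 := by norm_num
  have hcoef : ∀ n : ℤ, fourierCoeffOn hlt ψ n = 0 := by
    intro n
    rw [fourierCoeffOn_eq_integral]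
    have e1 : ∀ x : ℝ, fourier (-n) (x : AddCircle ((1:ℝ) - (-1))) • ψ x
        = exp (-I * nu n * x) * A x + exp (-I * nu n * x) * B (-x) := by
      intro x
      rw [fourier_coe_apply, smul_eq_mul, hψ]
      simp only
      rw [← mul_assoc, ← Complex.exp_add, ← mul_add]
      congr 2
      simp only [nu]
      push_cast
      field_simp
      ring
    simp only [e1]
    rw [intervalIntegral.integral_of_le hlt.le, setIntegral_eq_integral_of_forall_compl_eq_zero]
    swap
    · intro x hx
      rw [← mul_add, hsupp x hx, mul_zero]
    have i1 : ∀ c : ℝ, Integrable (fun x : ℝ => exp (-I * c * x) * A x) := fun c => by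
      refine hA1.bdd_mul (c := 1) (Continuous.aestronglyMeasurable (by fun_prop)) ?_
      exact Eventually.of_forall fun x => (norm_exp_neg_I c x).le
    have i2 : ∀ c : ℝ, Integrable (fun x : ℝ => exp (I * c * x) * B x) := fun c => by
      refine hB1.bdd_mul (c := 1) (Continuous.aestronglyMeasurable (by fun_prop)) ?_
      exact Eventually.of_forall fun x => (norm_exp_I c x).le
    have e2 : ∀ x : ℝ, exp (-I * nu n * x) * B (-x) =
        (fun y : ℝ => exp (I * nu n * y) * B y) (-x) := by
      intro x; simp
    simp only [e2]
    rw [integral_add (i1 _) ((i2 _).comp_neg), integral_neg_eq_self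
      (fun y : ℝ => exp (I * nu n * y) * B y), ← integral_add (i1 _) (i2 _)]
    have e3 : ∀ x : ℝ, exp (-I * nu n * x) * A x + exp (I * nu n * x) * B x
        = (Ioo (0:ℝ) 1).indicator
          (fun x : ℝ => 2 * ((exp (-I * nu n * x) * a x + exp (I * nu n * x) * b x) / 2)) x := by
      intro x
      by_cases hx : x ∈ Ioo (0:ℝ) 1
      · simp only [hA, hB, indicator_of_mem hx]; ring
      · simp only [hA, hB, indicator_of_notMem hx]; ring
    simp only [e3]
    rw [integral_indicator measurableSet_Ioo, integral_const_mul]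
    have := h n
    rw [μ01] at this
    rw [this]; simp
  have hP := hasSum_sq_fourierCoeffOn hlt (hψm.restrict (Ioc (-1) 1))
  simp only [hcoef] at hP
  have h0 : ∫ x in (-1:ℝ)..1, ‖ψ x‖ ^ 2 = 0 := by
    have h00 : HasSum (fun _ : ℤ => ‖(0:ℂ)‖ ^ 2) 0 := by simp
    have := hP.unique h00
    simpa using this
  rw [intervalIntegral.integral_of_le hlt.le, setIntegral_eq_integral_of_forall_compl_eq_zero
    (fun x hx => by rw [hnorm, hsupp x hx]; simp),
    integral_eq_zero_iff_of_nonneg (fun x => by positivity) (hψm.integrable_norm_pow two_ne_zero)] at h0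
  have hz : ∀ᵐ x, A x + B (-x) = 0 := by
    filter_upwards [h0] with x hx
    have : ‖A x + B (-x)‖ ^ 2 = 0 := by rw [← hnorm]; exact hx
    simpa using this
  have hz' : ∀ᵐ x, A (-x) + B x = 0 := by
    have := (Measure.measurePreserving_neg (volume : Measure ℝ)).quasiMeasurePreserving.ae hz
    simpa using this
  constructor
  · rw [μ01]
    filter_upwards [ae_restrict_of_ae hz, ae_restrict_mem measurableSet_Ioo] with x h1 hx
    have h2 : -x ∉ Ioo (0:ℝ) 1 := fun h => by linarith [h.1, hx.1]
    simpa [hA, hB, indicator_of_mem hx, indicator_of_notMem h2] using h1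
  · rw [μ01]
    filter_upwards [ae_restrict_of_ae hz', ae_restrict_mem measurableSet_Ioo] with x h1 hx
    have h2 : -x ∉ Ioo (0:ℝ) 1 := fun h => by linarith [h.1, hx.1]
    simpa [hA, hB, indicator_of_mem hx, indicator_of_notMem h2] using h1

lemma complete_nu (f : HH) (h : ∀ n : ℤ, inner ℂ (w 0 (nu n)) f = 0) : f = 0 := by
  have hc := memLp_coords f
  have hpt : f =ᵐ[μ01] fun x => pt ((f : ℝ → W) x 0 + I * (f : ℝ → W) x 1)
      ((f : ℝ → W) x 0 - I * (f : ℝ → W) x 1) := Eventually.of_forall fun x => eq_pt _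
  obtain ⟨h1, h2⟩ := complete_fourier hc.1 hc.2 (fun n => by rw [← inner_w _ f _ _ hpt]; exact h n)
  rw [Lp.eq_zero_iff_ae_eq_zero]
  filter_upwards [hpt, h1, h2] with x e1 e2 e3
  rw [e1, e2, e3]
  simp [pt_nil]

def bas : HilbertBasis ℤ ℂ HH := HilbertBasis.mkOfOrthogonalEqBot orthonormal_w (by
  rw [Submodule.eq_bot_iff]
  intro f hf
  apply complete_nu
  intro n
  exact (Submodule.mem_orthogonal _ _).1 hf _ (Submodule.subset_span ⟨n, rfl⟩))

lemma bas_apply (n : ℤ) : bas n = w 0 (nu n) := by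
  simp [bas]


/-- Tail integral. -/
def tail (u : ℝ → ℂ) (x : ℝ) : ℂ := ∫ t, (Ioi x).indicator u t ∂μ01

lemma integrable_tail_kernel {u v : ℝ → ℂ} (hu : Integrable u μ01) (hv : Integrable v μ01) :
    Integrable (fun z : ℝ × ℝ => v z.1 * (Ioi z.1).indicator u z.2) (μ01.prod μ01) := by
  have h := hv.mul_prod hu
  have hm : MeasurableSet {z : ℝ × ℝ | z.1 < z.2} := measurableSet_lt measurable_fst measurable_snd
  refine (h.indicator hm).congr (Eventually.of_forall fun z => ?_)
  by_cases hz : z.1 < z.2 <;> simp [indicator, hz]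

lemma aesm_tail {u : ℝ → ℂ} (hu : Integrable u μ01) : AEStronglyMeasurable (tail u) μ01 := by
  have := (integrable_tail_kernel hu (integrable_const (1:ℂ))).1.integral_prod_right'
  simpa [tail] using! this

lemma norm_tail_le {u : ℝ → ℂ} (hu : Integrable u μ01) (x : ℝ) :
    ‖tail u x‖ ≤ ∫ t, ‖u t‖ ∂μ01 := by
  refine norm_integral_le_of_norm_le hu.norm (Eventually.of_forall fun t => ?_)
  exact norm_indicator_le_norm_self _ _

lemma memLp_tail {u c : ℝ → ℂ} (hu : Integrable u μ01) (hc : Continuous c) (hc1 : ∀ x, ‖c x‖ = 1) :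
    MemLp (fun x => c x * tail u x) 2 μ01 := by
  refine MemLp.of_bound (hc.aestronglyMeasurable.mul (aesm_tail hu)) (∫ t, ‖u t‖ ∂μ01)
    (Eventually.of_forall fun x => ?_)
  rw [norm_mul, hc1, one_mul]
  exact norm_tail_le hu x

lemma ibp {u : ℝ → ℂ} (hu : Integrable u μ01) (s : ℂ) :
    ∫ x, (s * exp (s * x)) * tail u x ∂μ01 = ∫ x, exp (s * x) * u x ∂μ01 - ∫ x, u x ∂μ01 := by
  have hcont : Continuous fun x : ℝ => s * exp (s * x) := by fun_prop
  have hcont2 : Continuous fun x : ℝ => exp (s * x) := by fun_prop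
  have hi : ∀ {v : ℝ → ℂ}, Continuous v → Integrable v μ01 := fun {v} hv => by
    have : IntegrableOn v (Icc 0 1) := hv.continuousOn.integrableOn_Icc
    exact this.mono_set Ioo_subset_Icc_self
  have hk := integrable_tail_kernel hu (hi hcont)
  have hb : Integrable (fun x : ℝ => exp (s * x) * u x) μ01 := by
    refine hu.bdd_mul (c := Real.exp ‖s‖) hcont2.aestronglyMeasurable ?_
    filter_upwards [ae_mem] with x hx
    refine (norm_exp_le_exp_norm _).trans ?_
    rw [norm_mul, norm_real, Real.norm_of_nonneg hx.1.le]
    gcongr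
    exact mul_le_of_le_one_right (norm_nonneg _) hx.2.le
  calc ∫ x, (s * exp (s * x)) * tail u x ∂μ01
      = ∫ x, ∫ t, (s * exp (s * x)) * (Ioi x).indicator u t ∂μ01 ∂μ01 := by
        simp only [tail, integral_const_mul]
    _ = ∫ t, ∫ x : ℝ, (s * exp (s * x)) * (Ioi x).indicator u t ∂μ01 ∂μ01 :=
        integral_integral_swap hk
    _ = ∫ t, (exp (s * t) * u t - u t) ∂μ01 := by
        apply integral_congr_ae
        filter_upwards [ae_mem] with t ht
        have e : ∀ x : ℝ, (s * exp (s * x)) * (Ioi x).indicator u t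
            = (Iio t).indicator (fun x : ℝ => s * exp (s * x)) x * u t := by
          intro x
          by_cases hx : x < t <;> simp [indicator, hx]
        simp only [e]
        rw [integral_mul_const, integral_indicator measurableSet_Iio, μ01,
          Measure.restrict_restrict measurableSet_Iio]
        have hset : Iio t ∩ Ioo 0 1 = Ioo 0 t := by
          ext x; simp only [mem_inter_iff, mem_Iio, mem_Ioo]
          constructor
          · rintro ⟨a, b, c⟩; exact ⟨b, a⟩
          · rintro ⟨a, b⟩; exact ⟨b, a, b.trans ht.2⟩
        rw [hset, ← integral_Ioc_eq_integral_Ioo, ← intervalIntegral.integral_of_le ht.1.le]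
        have hd : ∀ x ∈ uIcc 0 t, HasDerivAt (fun x : ℝ => exp (s * x)) (s * exp (s * x)) x := by
          intro x _
          have h1 : HasDerivAt (fun x : ℝ => s * (x : ℂ)) s x := by
            simpa using (Complex.ofRealCLM.hasDerivAt (x := x)).const_mul s
          simpa [mul_comm] using h1.cexp
        rw [intervalIntegral.integral_eq_sub_of_hasDerivAt hd (hcont.intervalIntegrable _ _)]
        simp
        ring
    _ = _ := integral_sub hb hu

lemma memLp_pt {ga gb : ℝ → ℂ} (ha : MemLp ga 2 μ01) (hb : MemLp gb 2 μ01) :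
    MemLp (fun x => pt (ga x) (gb x)) 2 μ01 := by
  have h := ha.norm.add hb.norm
  refine MemLp.of_le h
    (continuous_pt.comp_aestronglyMeasurable (ha.1.prodMk hb.1))
    (Eventually.of_forall fun x => ?_)
  have : ‖ga x‖ + ‖gb x‖ ≤ ‖(((fun x => ‖ga x‖) + fun x => ‖gb x‖) x : ℝ)‖ := le_abs_self _
  refine le_trans (norm_pt_le_const ?_ ?_) this
  · linarith [norm_nonneg (gb x)]
  · linarith [norm_nonneg (ga x)]

lemma div_aux {a b : ℝ → ℂ} (ha : MemLp a 2 μ01) (hb : MemLp b 2 μ01) (l m : ℝ)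
    (hf : ∫ x, (exp (-I * l * x) * a x + exp (I * l * x) * b x) / 2 ∂μ01 = 0) :
    ∃ ga gb : ℝ → ℂ, MemLp ga 2 μ01 ∧ MemLp gb 2 μ01 ∧ ∀ z : ℝ,
      ((z : ℂ) - l) * ∫ x, (exp (-I * z * x) * ga x + exp (I * z * x) * gb x) / 2 ∂μ01
      = ((z : ℂ) - m) * ∫ x, (exp (-I * z * x) * a x + exp (I * z * x) * b x) / 2 ∂μ01 := by
  have hai := ha.integrable one_le_two
  have hbi := hb.integrable one_le_two
  have bm1 : ∀ (c : ℝ) {v : ℝ → ℂ}, Integrable v μ01 →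
      Integrable (fun x : ℝ => exp (-I * c * x) * v x) μ01 := fun c v hv =>
    hv.bdd_mul (c := 1) (Continuous.aestronglyMeasurable (by fun_prop))
      (Eventually.of_forall fun x => (norm_exp_neg_I c x).le)
  have bm2 : ∀ (c : ℝ) {v : ℝ → ℂ}, Integrable v μ01 →
      Integrable (fun x : ℝ => exp (I * c * x) * v x) μ01 := fun c v hv =>
    hv.bdd_mul (c := 1) (Continuous.aestronglyMeasurable (by fun_prop))
      (Eventually.of_forall fun x => (norm_exp_I c x).le)
  have split : ∀ (z : ℝ) {u v : ℝ → ℂ}, Integrable u μ01 → Integrable v μ01 →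
      ∫ x, (exp (-I * z * x) * u x + exp (I * z * x) * v x) / 2 ∂μ01
      = (∫ x, exp (-I * z * x) * u x ∂μ01 + ∫ x, exp (I * z * x) * v x ∂μ01) / 2 := by
    intro z u v hu hv
    rw [integral_div, integral_add (bm1 z hu) (bm2 z hv)]
  set ua : ℝ → ℂ := fun x => exp (-I * l * x) * a x with hua
  set ub : ℝ → ℂ := fun x => exp (I * l * x) * b x with hub
  have huai : Integrable ua μ01 := bm1 l hai
  have hubi : Integrable ub μ01 := bm2 l hbi
  set pa : ℝ → ℂ := fun x => exp (I * l * x) * tail ua x with hpa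
  set pb : ℝ → ℂ := fun x => exp (-I * l * x) * tail ub x with hpb
  have hpam : MemLp pa 2 μ01 := memLp_tail huai (by fun_prop) (fun x => norm_exp_I l x)
  have hpbm : MemLp pb 2 μ01 := memLp_tail hubi (by fun_prop) (fun x => norm_exp_neg_I l x)
  have hpai := hpam.integrable one_le_two
  have hpbi := hpbm.integrable one_le_two
  set k : ℂ := (l : ℂ) - m
  set ga : ℝ → ℂ := fun x => a x + (-I * k) * pa x with hga
  set gb : ℝ → ℂ := fun x => b x + (I * k) * pb x with hgb
  have hgam : MemLp ga 2 μ01 := ha.add (hpam.const_mul _)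
  have hgbm : MemLp gb 2 μ01 := hb.add (hpbm.const_mul _)
  refine ⟨ga, gb, hgam, hgbm, fun z => ?_⟩
  rw [split l hai hbi] at hf
  rw [split z (hgam.integrable one_le_two) (hgbm.integrable one_le_two), split z hai hbi]
  have ea : ∫ x, exp (-I * z * x) * ga x ∂μ01 = ∫ x, exp (-I * z * x) * a x ∂μ01
      + (-I * k) * ∫ x, exp (-I * z * x) * pa x ∂μ01 := by
    rw [← integral_const_mul, ← integral_add (bm1 z hai) ((bm1 z hpai).const_mul _)]
    congr 1; ext x; simp only [hga]; ring
  have eb : ∫ x, exp (I * z * x) * gb x ∂μ01 = ∫ x, exp (I * z * x) * b x ∂μ01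
      + (I * k) * ∫ x, exp (I * z * x) * pb x ∂μ01 := by
    rw [← integral_const_mul, ← integral_add (bm2 z hbi) ((bm2 z hpbi).const_mul _)]
    congr 1; ext x; simp only [hgb]; ring
  have ia := ibp huai (-I * (z - l))
  have ib := ibp hubi (I * (z - l))
  have ia1 : ∫ x : ℝ, (-I * (z - l)) * exp (-I * (z - l) * x) * tail ua x ∂μ01
      = (-I * (z - l)) * ∫ x, exp (-I * z * x) * pa x ∂μ01 := by
    rw [← integral_const_mul]
    congr 1; ext x; simp only [hpa]
    rw [← mul_assoc (exp _), ← Complex.exp_add, ← mul_assoc]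
    congr 3; ring
  have ib1 : ∫ x : ℝ, (I * (z - l)) * exp (I * (z - l) * x) * tail ub x ∂μ01
      = (I * (z - l)) * ∫ x, exp (I * z * x) * pb x ∂μ01 := by
    rw [← integral_const_mul]
    congr 1; ext x; simp only [hpb]
    rw [← mul_assoc (exp _), ← Complex.exp_add, ← mul_assoc]
    congr 3; ring
  have ia2 : ∫ x : ℝ, exp (-I * (z - l) * x) * ua x ∂μ01 = ∫ x, exp (-I * z * x) * a x ∂μ01 := by
    congr 1; ext x; simp only [hua]
    rw [← mul_assoc, ← Complex.exp_add]
    congr 2; ring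
  have ib2 : ∫ x : ℝ, exp (I * (z - l) * x) * ub x ∂μ01 = ∫ x, exp (I * z * x) * b x ∂μ01 := by
    congr 1; ext x; simp only [hub]
    rw [← mul_assoc, ← Complex.exp_add]
    congr 2; ring
  rw [ia1, ia2] at ia
  rw [ib1, ib2] at ib
  rw [ea, eb]
  change (∫ x, ua x ∂μ01 + ∫ x, ub x ∂μ01) / 2 = 0 at hf
  linear_combination (k / 2) * ia + (k / 2) * ib - k * hf

/-- Division step: a zero of the transform can be moved from `l` to `m`. -/
lemma div_step (f : HH) (l m : ℝ) (hf : inner ℂ (w 0 l) f = 0) :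
    ∃ g : HH, ∀ z : ℝ, ((z : ℂ) - l) * inner ℂ (w 0 z) g = ((z : ℂ) - m) * inner ℂ (w 0 z) f := by
  obtain ⟨ha, hb⟩ := memLp_coords f
  have hpt : f =ᵐ[μ01] fun x => pt ((f : ℝ → W) x 0 + I * (f : ℝ → W) x 1)
      ((f : ℝ → W) x 0 - I * (f : ℝ → W) x 1) := Eventually.of_forall fun x => eq_pt _
  rw [inner_w l f _ _ hpt] at hf
  obtain ⟨ga, gb, h1, h2, h⟩ := div_aux ha hb l m hf
  refine ⟨(memLp_pt h1 h2).toLp, fun z => ?_⟩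
  rw [inner_w z _ ga gb (memLp_pt h1 h2).coeFn_toLp, inner_w z f _ _ hpt]
  exact h z


abbrev L2Z := lp (fun _ : ℤ => ℂ) 2

lemma norm_sum_basis (s : Finset ℤ) (b : ℤ → ℂ) :
    ‖∑ n ∈ s, b n • w 0 (nu n)‖ = Real.sqrt (∑ n ∈ s, ‖b n‖ ^ 2) := by
  have h := orthonormal_w.inner_sum b b s
  rw [inner_self_eq_norm_sq_to_K] at h
  have e : ∀ z : ℂ, (starRingEnd ℂ) z * z = ((‖z‖ ^ 2 : ℝ) : ℂ) := fun z => by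
    simpa using Complex.conj_mul' z
  simp only [e] at h
  have h' : ‖∑ n ∈ s, b n • w 0 (nu n)‖ ^ 2 = ∑ n ∈ s, ‖b n‖ ^ 2 := by
    apply Complex.ofReal_injective
    push_cast at h ⊢
    exact h
  rw [← h', Real.sqrt_sq (norm_nonneg _)]

lemma pert_bound (d : ℤ → ℝ) (hd : ∀ n, |d n| ≤ 1 / 2) (s : Finset ℤ) (a : ℤ → ℂ) :
    ‖∑ n ∈ s, a n • (w 0 (nu n + d n) - w 0 (nu n))‖
      ≤ (Real.exp (1 / 2) - 1) * Real.sqrt (∑ n ∈ s, ‖a n‖ ^ 2) := by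
  set Q := Real.sqrt (∑ n ∈ s, ‖a n‖ ^ 2) with hQ
  have hQ0 : 0 ≤ Q := Real.sqrt_nonneg _
  have main : ∀ K : ℕ, ‖∑ n ∈ s, a n • (w 0 (nu n + d n) - w 0 (nu n))‖
      ≤ (∑ n ∈ s, ‖a n‖) * Real.exp (1 / 2) * (1 / 2 : ℝ) ^ (K + 1)
        + (Real.exp (1 / 2) - 1) * Q := by
    intro K
    have e : ∑ n ∈ s, a n • (w 0 (nu n + d n) - w 0 (nu n))
        = ∑ n ∈ s, a n • (w 0 (nu n + d n) - ∑ k ∈ Finset.range (K + 1),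
            ((d n : ℂ) ^ k / (k.factorial : ℂ)) • w k (nu n))
          + ∑ k ∈ Finset.range K, ∑ n ∈ s,
            (a n * ((d n : ℂ) ^ (k + 1) / ((k + 1).factorial : ℂ))) • w (k + 1) (nu n) := by
      rw [Finset.sum_comm, ← Finset.sum_add_distrib]
      refine Finset.sum_congr rfl fun n _ => ?_
      rw [Finset.sum_range_succ']
      simp only [mul_smul, ← Finset.smul_sum, ← smul_add]
      congr 1
      simp
      abel
    rw [e]
    refine (norm_add_le _ _).trans (add_le_add ?_ ?_)
    · refine (norm_sum_le _ _).trans ?_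
      rw [Finset.sum_mul, Finset.sum_mul]
      refine Finset.sum_le_sum fun n _ => ?_
      rw [norm_smul, mul_assoc]
      refine mul_le_mul_of_nonneg_left ((norm_taylor _ _ _).trans ?_) (norm_nonneg _)
      rw [mul_comm]
      have := hd n
      gcongr
    · refine (norm_sum_le _ _).trans ?_
      have h1 : ∀ k ∈ Finset.range K, ‖∑ n ∈ s,
          (a n * ((d n : ℂ) ^ (k + 1) / ((k + 1).factorial : ℂ))) • w (k + 1) (nu n)‖
          ≤ (1 / 2 : ℝ) ^ (k + 1) / ((k + 1).factorial : ℝ) * Q := by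
        intro k _
        refine (norm_sum_w_le _ _ _ _).trans ?_
        rw [norm_sum_basis]
        apply Real.sqrt_le_iff.2
        refine ⟨by positivity, ?_⟩
        rw [mul_pow, hQ, Real.sq_sqrt (Finset.sum_nonneg fun _ _ => by positivity), Finset.mul_sum]
        refine Finset.sum_le_sum fun n _ => ?_
        rw [norm_mul, mul_pow, mul_comm]
        have h2 : ‖(d n : ℂ) ^ (k + 1) / ((k + 1).factorial : ℂ)‖
            ≤ (1 / 2 : ℝ) ^ (k + 1) / ((k + 1).factorial : ℝ) := by
          rw [norm_div, norm_pow, norm_real, Real.norm_eq_abs, norm_natCast]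
          have := hd n
          gcongr
        gcongr
      refine (Finset.sum_le_sum h1).trans ?_
      rw [← Finset.sum_mul]
      refine mul_le_mul_of_nonneg_right ?_ hQ0
      have h3 := Real.sum_le_exp_of_nonneg (x := 1 / 2) (by norm_num) (K + 1)
      rw [Finset.sum_range_succ'] at h3
      simp only [pow_zero, Nat.factorial_zero, Nat.cast_one, div_one] at h3
      linarith
  have hlim : Tendsto (fun K : ℕ => (∑ n ∈ s, ‖a n‖) * Real.exp (1 / 2) * (1 / 2 : ℝ) ^ (K + 1)
        + (Real.exp (1 / 2) - 1) * Q) atTop (nhds ((Real.exp (1 / 2) - 1) * Q)) := by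
    have h := (tendsto_pow_atTop_nhds_zero_of_lt_one (r := (1 / 2 : ℝ)) (by norm_num)
      (by norm_num)).comp (tendsto_add_atTop_nat 1)
    have h2 := (h.const_mul ((∑ n ∈ s, ‖a n‖) * Real.exp (1 / 2))).add_const
      ((Real.exp (1 / 2) - 1) * Q)
    simpa using h2
  exact ge_of_tendsto' hlim main

lemma summable_sq (a : L2Z) : Summable fun n => ‖a n‖ ^ 2 := by
  have := (lp.memℓp a).summable (by norm_num)
  simpa using this

lemma sum_sq_le (a : L2Z) (s : Finset ℤ) : Real.sqrt (∑ n ∈ s, ‖a n‖ ^ 2) ≤ ‖a‖ := by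
  rw [Real.sqrt_le_left (norm_nonneg _)]
  have := lp.sum_rpow_le_norm_rpow (p := 2) (by norm_num) a s
  simpa using this

lemma exists_synth (f : ℤ → HH) (C : ℝ) (hC : 0 ≤ C)
    (h : ∀ (s : Finset ℤ) (a : ℤ → ℂ), ‖∑ n ∈ s, a n • f n‖ ≤ C * Real.sqrt (∑ n ∈ s, ‖a n‖ ^ 2)) :
    ∃ S : L2Z →L[ℂ] HH, ‖S‖ ≤ C ∧ ∀ a : L2Z, HasSum (fun n => a n • f n) (S a) := by
  have hs : ∀ a : L2Z, Summable fun n => a n • f n := by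
    intro a
    rw [summable_iff_vanishing_norm]
    intro ε hε
    obtain ⟨s, hs⟩ := summable_iff_vanishing_norm.1 (summable_sq a) ((ε / (C + 1)) ^ 2) (by positivity)
    refine ⟨s, fun t ht => ?_⟩
    have h1 := hs t ht
    rw [Real.norm_of_nonneg (Finset.sum_nonneg fun _ _ => by positivity)] at h1
    have h2 : Real.sqrt (∑ n ∈ t, ‖a n‖ ^ 2) < ε / (C + 1) := by
      rw [Real.sqrt_lt' (by positivity)]; exact h1
    calc _ ≤ C * Real.sqrt (∑ n ∈ t, ‖a n‖ ^ 2) := h t _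
      _ ≤ C * (ε / (C + 1)) := by gcongr
      _ < ε := by
        rw [← mul_div_assoc, div_lt_iff₀ (by positivity)]
        nlinarith
  let S0 : L2Z →ₗ[ℂ] HH :=
    { toFun := fun a => ∑' n, a n • f n
      map_add' := fun a b => by
        rw [← (hs a).tsum_add (hs b)]
        congr 1; ext1 n
        rw [← add_smul]; rfl
      map_smul' := fun c a => by
        rw [RingHom.id_apply, ← (hs a).tsum_const_smul c]
        congr 1; ext1 n
        rw [smul_smul]; rfl }
  have hb : ∀ a, ‖S0 a‖ ≤ C * ‖a‖ := by
    intro a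
    refine le_of_tendsto' (hs a).hasSum.norm fun s => ?_
    exact (h s _).trans (mul_le_mul_of_nonneg_left (sum_sq_le a s) hC)
  exact ⟨S0.mkContinuous C hb, S0.mkContinuous_norm_le hC hb, fun a => (hs a).hasSum⟩

lemma exp_half_lt : Real.exp (1 / 2) - 1 < 1 := by
  have h : Real.exp (1 / 2) ^ 2 = Real.exp 1 := by
    rw [← Real.exp_nat_mul]; norm_num
  have := Real.exp_one_lt_d9
  nlinarith [Real.exp_pos (1 / 2)]

lemma exists_small (l : ℤ → ℝ) (hl : ∀ n, |l n - nu n| ≤ 1 / 2) :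
    ∃ T : L2Z ≃L[ℂ] HH, ∀ a : L2Z, HasSum (fun n => a n • w 0 (l n)) (T a) := by
  have hC : 0 ≤ Real.exp (1 / 2) - 1 := by
    have := Real.add_one_le_exp (1 / 2 : ℝ); linarith
  obtain ⟨S, hS, hSum⟩ := exists_synth (fun n => w 0 (l n) - w 0 (nu n)) _ hC (fun s a => by
    have := pert_bound (fun n => l n - nu n) hl s a
    simpa using this)
  let e : L2Z ≃L[ℂ] HH := bas.repr.symm.toContinuousLinearEquiv
  let R : L2Z →L[ℂ] L2Z := (e.symm : HH →L[ℂ] L2Z).comp S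
  have hR : ‖-R‖ < 1 := by
    rw [norm_neg]
    refine lt_of_le_of_lt (ContinuousLinearMap.opNorm_le_bound _ hC fun a => ?_) exp_half_lt
    have : ‖R a‖ = ‖S a‖ := bas.repr.norm_map (S a)
    rw [this]
    exact (S.le_opNorm a).trans (by gcongr)
  let U := ContinuousLinearEquiv.ofUnit (Units.oneSub (-R) hR)
  refine ⟨U.trans e, fun a => ?_⟩
  have h1 : (U.trans e) a = e a + S a := by
    have hU : U a = a + e.symm (S a) := by
      change ((1 : L2Z →L[ℂ] L2Z) - (-R)) a = _
      simp [R]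
    rw [ContinuousLinearEquiv.trans_apply, hU, map_add, e.apply_symm_apply]
  rw [h1]
  have h2 : HasSum (fun n => a n • w 0 (nu n)) (e a) := by
    have := bas.hasSum_repr_symm a
    simp only [bas_apply] at this
    exact this
  convert h2.add (hSum a) using 1
  ext1 n
  rw [← smul_add, add_sub_cancel]

lemma compact_sum {X : Type*} [NormedAddCommGroup X] [InnerProductSpace ℂ X]
    (F : Finset ℤ) (y u : ℤ → X) :
    IsCompactOperator (∑ n ∈ F, (innerSL ℂ (u n)).smulRight (y n) : X →L[ℂ] X) := by
  classical
  induction F using Finset.induction_on with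
  | empty => simpa using! isCompactOperator_zero
  | insert a s ha ih =>
    rw [Finset.sum_insert ha]
    have h1 : IsCompactOperator ((innerSL ℂ (u a)).smulRight (y a) : X →L[ℂ] X) := by
      have h0 : IsCompactOperator (id : ℂ → ℂ) := isCompactOperator_id
      exact (h0.clm_comp (ContinuousLinearMap.toSpanSingleton ℂ (y a))).comp_clm (innerSL ℂ (u a))
    exact h1.add ih

lemma fredholm {X : Type*} [NormedAddCommGroup X] [InnerProductSpace ℂ X] [CompleteSpace X]
    (F : Finset ℤ) (y u : ℤ → X)
    (h : ∀ f : X, (∀ g, inner ℂ f (g + ∑ n ∈ F, inner ℂ (y n) g • u n) = 0) → f = 0) :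
    ∃ A : X ≃L[ℂ] X, ∀ g, A g = g + ∑ n ∈ F, inner ℂ (y n) g • u n := by
  let K : X →L[ℂ] X := ∑ n ∈ F, (innerSL ℂ (y n)).smulRight (u n)
  let K2 : X →L[ℂ] X := ∑ n ∈ F, (innerSL ℂ (u n)).smulRight (y n)
  have hK : ∀ g, K g = ∑ n ∈ F, inner ℂ (y n) g • u n := fun g => by
    simp [K]
  have hK2 : ∀ g, K2 g = ∑ n ∈ F, inner ℂ (u n) g • y n := fun g => by
    simp [K2]
  have hadj : ∀ f g, inner ℂ (K2 f) g = inner ℂ f (K g) := by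
    intro f g
    rw [hK, hK2, sum_inner, inner_sum]
    refine Finset.sum_congr rfl fun n _ => ?_
    rw [inner_smul_left, inner_smul_right, inner_conj_symm, mul_comm]
  have hA : ContinuousLinearMap.adjoint K2 = K := by
    symm
    rw [ContinuousLinearMap.eq_adjoint_iff]
    intro x z
    rw [← inner_conj_symm, ← hadj, inner_conj_symm]
  have hu : IsUnit (1 + K2) := by
    have hc : IsCompactOperator K2 := compact_sum F y u
    rcases hc.hasEigenvalue_or_mem_resolventSet (μ := (-1 : ℂ)) (by norm_num) with h1 | h1
    · exfalso
      obtain ⟨f, hf⟩ := h1.exists_hasEigenvector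
      apply hf.2
      apply h
      intro g
      have h2 : K2 f = -f := by simpa using hf.apply_eq_smul
      rw [inner_add_right, ← hK, ← hadj, h2]
      simp
    · rw [spectrum.mem_resolventSet_iff] at h1
      have : 1 + K2 = -((algebraMap ℂ (X →L[ℂ] X)) (-1) - K2) := by
        simp [add_comm]
      rw [this]
      exact h1.neg
  have hu2 : IsUnit (1 + K) := by
    have := hu.star
    rw [star_add, star_one, ContinuousLinearMap.star_eq_adjoint, hA] at this
    exact this
  obtain ⟨V, hV⟩ := hu2
  refine ⟨ContinuousLinearEquiv.ofUnit V, fun g => ?_⟩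
  rw [← hK]
  change (V : X →L[ℂ] X) g = _
  rw [hV]
  simp


lemma fc_tendsto (g : ℝ → ℂ) : Tendsto (fun n : ℤ => fc g n) cofinite (nhds 0) := by
  have h := (Real.tendsto_integral_exp_smul_cocompact
    (indicator (Ioc (0:ℝ) 1) g)).comp Int.tendsto_coe_cofinite
  refine h.congr fun n => ?_
  simp only [Function.comp_apply, fc]
  rw [intervalIntegral.integral_of_le zero_le_one, ← integral_indicator measurableSet_Ioc]
  congr 1
  ext x
  by_cases hx : x ∈ Ioc (0:ℝ) 1
  · rw [indicator_of_mem hx, indicator_of_mem hx, Circle.smul_def, Real.fourierChar_apply,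
      smul_eq_mul]
    congr 2
    push_cast
    ring
  · rw [indicator_of_notMem hx, indicator_of_notMem hx, smul_zero]

lemma exists_finset (p : ℝ≥0∞) (lam : ℤ → ℝ) (hla : LamAsymp p lam) :
    ∃ F : Finset ℤ, ∀ n, n ∉ F → |lam n - nu n| ≤ 1 / 2 := by
  obtain ⟨g, -, hg⟩ := hla
  have h := (Metric.tendsto_nhds.1 (fc_tendsto g)) (1 / 2) (by norm_num)
  rw [eventually_cofinite] at h
  refine ⟨h.toFinset, fun n hn => ?_⟩
  simp only [Set.Finite.mem_toFinset, Set.mem_ofPred_eq, not_not, dist_zero_right] at hn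
  have e : fc g n = ((lam n - nu n : ℝ) : ℂ) := by
    rw [Complex.ofReal_sub, hg n, nu]
    push_cast
    ring
  rw [e, Complex.norm_real, Real.norm_eq_abs] at hn
  exact hn.le

lemma exists_m (lam : ℤ → ℝ) : ∃ m : ℤ → ℝ, (∀ n, |m n - nu n| ≤ 1 / 2) ∧
    (∀ n k, m n ≠ lam k) ∧ (∀ n k, m n ≠ nu k) := by
  have hc : (range lam ∪ range nu).Countable := (countable_range _).union (countable_range _)
  have hd := hc.dense_compl ℝ
  have : ∀ n, ∃ y, |y - nu n| ≤ 1 / 2 ∧ y ∉ range lam ∪ range nu := by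
    intro n
    obtain ⟨y, hy, hy2⟩ := hd.exists_mem_open (Metric.isOpen_ball (x := nu n) (ε := 1/2))
      ⟨nu n, Metric.mem_ball_self (by norm_num)⟩
    exact ⟨y, (Metric.mem_ball.1 hy2).le, hy⟩
  choose m hm1 hm2 using this
  refine ⟨m, hm1, fun n k h => hm2 n (Or.inl ⟨k, h.symm⟩), fun n k h => hm2 n (Or.inr ⟨k, h.symm⟩)⟩

lemma exchange (lam m : ℤ → ℝ) (hinj : Function.Injective lam)
    (h1 : ∀ n k, m n ≠ lam k) (h2 : ∀ n k, m n ≠ nu k) (f : HH)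
    (hf : ∀ n, inner ℂ (w 0 (lam n)) f = 0) (F : Finset ℤ) :
    ∃ g : HH, (∀ n ∈ F, inner ℂ (w 0 (m n)) g = 0) ∧
      (∀ n, n ∉ F → inner ℂ (w 0 (lam n)) g = 0) ∧ (g = 0 → f = 0) := by
  classical
  induction F using Finset.induction_on with
  | empty => exact ⟨f, by simp, fun n _ => hf n, id⟩
  | insert k s hk ih =>
    obtain ⟨g, hg1, hg2, hg3⟩ := ih
    obtain ⟨g', hg'⟩ := div_step g (lam k) (m k) (hg2 k hk)
    have key : ∀ z : ℝ, z ≠ lam k → (z = m k ∨ inner ℂ (w 0 z) g = 0) →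
        inner ℂ (w 0 z) g' = 0 := by
      intro z hz hz2
      have hh := hg' z
      have h0 : ((z:ℂ) - m k) * inner ℂ (w 0 z) g = 0 := by
        rcases hz2 with h | h
        · rw [h, sub_self, zero_mul]
        · rw [h, mul_zero]
      rw [h0] at hh
      rcases mul_eq_zero.1 hh with h | h
      · exact absurd (Complex.ofReal_injective (sub_eq_zero.1 h)) hz
      · exact h
    refine ⟨g', ?_, ?_, ?_⟩
    · intro n hn
      rcases Finset.mem_insert.1 hn with rfl | hn
      · exact key _ (h1 _ _) (Or.inl rfl)
      · exact key _ (h1 _ _) (Or.inr (hg1 n hn))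
    · intro n hn
      rw [Finset.mem_insert, not_or] at hn
      exact key _ (fun h => hn.1 (hinj h)) (Or.inr (hg2 n hn.2))
    · intro h0
      apply hg3
      apply complete_nu
      intro n
      have hh := hg' (nu n)
      rw [h0, inner_zero_right, mul_zero] at hh
      rcases mul_eq_zero.1 hh.symm with h | h
      · exact absurd (Complex.ofReal_injective (sub_eq_zero.1 h)).symm (h2 _ _)
      · exact h

lemma eq_zero_of_ortho (l : ℤ → ℝ) (T : L2Z ≃L[ℂ] HH)
    (hT : ∀ a, HasSum (fun n => a n • w 0 (l n)) (T a)) (g : HH)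
    (hg : ∀ n, inner ℂ (w 0 (l n)) g = 0) : g = 0 := by
  have h := hT (T.symm g)
  rw [T.apply_symm_apply] at h
  have h2 : HasSum (fun n => inner ℂ g ((T.symm g) n • w 0 (l n))) (inner ℂ g g) :=
    h.mapL (innerSL ℂ g)
  have h3 : (fun n => inner ℂ g ((T.symm g) n • w 0 (l n))) = fun _ => (0:ℂ) := by
    ext n
    rw [inner_smul_right, ← inner_conj_symm, hg, map_zero, mul_zero]
  rw [h3] at h2
  exact inner_self_eq_zero.1 (h2.unique hasSum_zero)

lemma exists_basis (p : ℝ≥0∞) (lam : ℤ → ℝ) (hmono : StrictMono lam) (hla : LamAsymp p lam) :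
    ∃ T : L2Z ≃L[ℂ] HH, ∀ a, HasSum (fun n => a n • w 0 (lam n)) (T a) := by
  classical
  obtain ⟨F, hF⟩ := exists_finset p lam hla
  obtain ⟨m, hm, hm1, hm2⟩ := exists_m lam
  let l : ℤ → ℝ := fun n => if n ∈ F then m n else lam n
  have hlF : ∀ n ∈ F, l n = m n := fun n hn => if_pos hn
  have hlF' : ∀ n, n ∉ F → l n = lam n := fun n hn => if_neg hn
  have hl : ∀ n, |l n - nu n| ≤ 1 / 2 := by
    intro n
    by_cases hn : n ∈ F
    · rw [hlF n hn]; exact hm n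
    · rw [hlF' n hn]; exact hF n hn
  obtain ⟨T, hT⟩ := exists_small l hl
  have hcomp : ∀ f : HH, (∀ n, inner ℂ (w 0 (lam n)) f = 0) → f = 0 := by
    intro f hf
    obtain ⟨g, hg1, hg2, hg3⟩ := exchange lam m hmono.injective hm1 hm2 f hf F
    apply hg3
    apply eq_zero_of_ortho l T hT
    intro n
    by_cases hn : n ∈ F
    · rw [hlF n hn]; exact hg1 n hn
    · rw [hlF' n hn]; exact hg2 n hn
  let y : ℤ → HH := fun n => ContinuousLinearMap.adjoint (T.symm : HH →L[ℂ] L2Z)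
    (lp.single 2 n (1:ℂ))
  let u : ℤ → HH := fun n => w 0 (lam n) - w 0 (l n)
  have hy : ∀ n g, inner ℂ (y n) g = (T.symm g) n := by
    intro n g
    simp only [y]
    rw [ContinuousLinearMap.adjoint_inner_left, lp.inner_single_left]
    simp
  have hu : ∀ n, n ∉ F → u n = 0 := fun n hn => by simp only [u]; rw [hlF' n hn, sub_self]
  obtain ⟨A, hA⟩ : ∃ A : HH ≃L[ℂ] HH, ∀ g, A g = g + ∑ n ∈ F, inner ℂ (y n) g • u n := by
    apply fredholm
    intro f hf
    apply hcomp
    intro k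
    have hk := hf (T (lp.single 2 k (1:ℂ)))
    have e1 : T (lp.single 2 k (1:ℂ)) = w 0 (l k) := by
      refine (hT _).unique ?_
      convert hasSum_single k ?_ using 1
      · simp
      · intro n hn
        simp [lp.single_apply, hn]
    have e2 : ∑ n ∈ F, inner ℂ (y n) (T (lp.single 2 k (1:ℂ))) • u n = u k := by
      rw [Finset.sum_eq_single k]
      · rw [hy, T.symm_apply_apply]; simp
      · intro n _ hn
        rw [hy, T.symm_apply_apply]
        simp [lp.single_apply, hn]
      · intro hk
        rw [hu k hk, smul_zero]
    rw [e2, e1, add_sub_cancel] at hk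
    rw [← inner_conj_symm, hk, map_zero]
  refine ⟨T.trans A, fun a => ?_⟩
  rw [ContinuousLinearEquiv.trans_apply, hA]
  have hs : HasSum (fun n => inner ℂ (y n) (T a) • u n) (∑ n ∈ F, inner ℂ (y n) (T a) • u n) :=
    hasSum_sum_of_ne_finset_zero fun n hn => by rw [hu n hn, smul_zero]
  convert (hT a).add hs using 1
  ext1 n
  rw [hy, T.symm_apply_apply, ← smul_add, add_sub_cancel]

lemma final_conv (lam : ℤ → ℝ) (T : L2Z ≃L[ℂ] HH)
    (hT : ∀ a, HasSum (fun n => a n • w 0 (lam n)) (T a)) (a : L2Z) :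
    Tendsto (fun N : ℕ =>
          eLpNorm (fun x : ℝ =>
            (∑ n ∈ Finset.Icc (-(N:ℤ)) (N:ℤ),
              a n • (WithLp.equiv 2 (Fin 2 → ℂ)).symm (c0 (lam n) x)) - T a x) 2 μ01)
          atTop (nhds 0) := by
  have h : Tendsto (fun N : ℕ => ∑ n ∈ Finset.Icc (-(N:ℤ)) (N:ℤ), a n • w 0 (lam n)) atTop
      (nhds (T a)) := (hT a).comp Finset.tendsto_Icc_neg
  have h2 : Tendsto (fun N : ℕ => ‖(∑ n ∈ Finset.Icc (-(N:ℤ)) (N:ℤ), a n • w 0 (lam n)) - T a‖ₑ)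
      atTop (nhds 0) := by
    have := (h.sub_const (T a)).enorm
    simpa using this
  refine h2.congr fun N => ?_
  rw [Lp.enorm_def]
  apply eLpNorm_congr_ae
  have h3 := coe_sum (Finset.Icc (-(N:ℤ)) (N:ℤ)) (fun n => a n • w 0 (lam n))
    (fun n x => a n • wf 0 (lam n) x) (fun n => coe_smul_of _ (coe_w 0 (lam n)))
  filter_upwards [Lp.coeFn_sub (∑ n ∈ Finset.Icc (-(N:ℤ)) (N:ℤ), a n • w 0 (lam n)) (T a), h3]
    with x hx1 hx2
  rw [hx1, Pi.sub_apply, hx2]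
  simp only [wf_zero]


end RB

/-- The system `v_n(x) = (cos λ_n x, sin λ_n x)ᵗ` is a Riesz basis of
`ℍ = L₂((0,1),ℂ²)`. -/
theorem statement12 (p : ℝ≥0∞) (hp : 1 ≤ p) (hp' : p ≠ ∞)
    (lam : ℤ → ℝ) (hmono : StrictMono lam) (hla : LamAsymp p lam) :
    ∃ T : lp (fun _ : ℤ => ℂ) 2 ≃L[ℂ] Lp (EuclideanSpace ℂ (Fin 2)) 2 μ01,
      ∀ a : lp (fun _ : ℤ => ℂ) 2,
        Tendsto (fun N : ℕ =>
          eLpNorm (fun x : ℝ =>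
            (∑ n ∈ Finset.Icc (-(N:ℤ)) (N:ℤ),
              a n • (WithLp.equiv 2 (Fin 2 → ℂ)).symm (c0 (lam n) x)) - T a x) 2 μ01)
          atTop (nhds 0) := by
  obtain ⟨T, hT⟩ := RB.exists_basis p lam hmono hla
  exact ⟨T, fun a => RB.final_conv lam T hT a⟩
end
end

section
/- Let p ∈ [1,∞). Let (λ_n)_{n∈ℤ} be a strictly increasing real sequence with λ_n = π(n+1/2) + e_n(g₁) for some g₁ ∈ L_p(0,1), and let (α_n)_{n∈ℤ} be positive reals with α_n = 1 + e_n(g₂) for some g₂ ∈ L_p(0,1). Let H ∈ L_p((−1,1),M₂) be the sum of the series Σ_{n∈ℤ} (α_n e^{−2λ_n sB} − e^{−π(2n+1)sB}) (symmetric partial sums for p > 1, Cesàro means for p = 1), and let 𝓗 be the integral operator on ℍ given by (𝓗u)(x) = ∫₀¹ H(x−s) u(s) ds. Then the operator I + 𝓗 is uniformly positive: there exists C > 0 such that ⟨(I + 𝓗)u, u⟩ ≥ C‖u‖² for all u ∈ ℍ. -/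
open MeasureTheory Complex Filter Set
open scoped Matrix.Norms.L2Operator ENNReal

noncomputable section

/-- `H ∈ L_p((-1,1),M₂)` is the sum of the series
`Σ_{n∈ℤ} (α_n e^{-2λ_n sB} - e^{-π(2n+1) sB})` (in the sense of symmetric partial sums for
`p > 1` and of Cesàro means for `p = 1`). -/
def IsHSum (p : ℝ≥0∞) (lam al : ℤ → ℝ) (H : ℝ → M2) : Prop :=
  MemLp H p μ11 ∧
  (1 < p → Tendsto (fun N : ℕ => eLpNorm (fun s : ℝ =>
      (∑ n ∈ Finset.Icc (-(N:ℤ)) (N:ℤ),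
        ((al n : ℂ) • expB (2 * (lam n : ℂ) * (s : ℂ)) -
          expB (Real.pi * (2 * (n : ℂ) + 1) * (s : ℂ)))) - H s) p μ11)
    atTop (nhds 0)) ∧
  (p = 1 → Tendsto (fun N : ℕ => eLpNorm (fun s : ℝ =>
      ((N : ℂ)⁻¹ • ∑ k ∈ Finset.Icc 1 N, ∑ n ∈ Finset.Icc (-(k:ℤ)) (k:ℤ),
        ((al n : ℂ) • expB (2 * (lam n : ℂ) * (s : ℂ)) -
          expB (Real.pi * (2 * (n : ℂ) + 1) * (s : ℂ)))) - H s) 1 μ11)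
    atTop (nhds 0))


/-! ### The scalar Fourier transform on `(0,1)` -/

instance : IsFiniteMeasure μ01 := by
  unfold μ01; exact ⟨by simp⟩

instance : IsFiniteMeasure μ11 := by
  unfold μ11; exact ⟨by simp⟩

def Ft (f : ℝ → ℂ) (l : ℝ) : ℂ := ∫ s, Complex.exp (-(2 * l * s : ℝ) * Complex.I) * f s ∂μ01

lemma norm_ee (l s : ℝ) : ‖Complex.exp (-(2 * l * s : ℝ) * Complex.I)‖ = 1 := by
  have := Complex.norm_exp_ofReal_mul_I (-(2 * l * s))
  push_cast at this ⊢
  exact this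

lemma cont_ee (l : ℝ) : Continuous (fun s : ℝ => Complex.exp (-(2 * l * s : ℝ) * Complex.I)) := by
  fun_prop

lemma memLp_ee {f : ℝ → ℂ} {p : ℝ≥0∞} (hf : MemLp f p μ01) (l : ℝ) :
    MemLp (fun s : ℝ => Complex.exp (-(2 * l * s : ℝ) * Complex.I) * f s) p μ01 := by
  refine hf.of_le ((cont_ee l).aestronglyMeasurable.mul hf.1) ?_
  filter_upwards with s
  rw [norm_mul, norm_ee, one_mul]

lemma integrable_of_two {f : ℝ → ℂ} (hf : MemLp f 2 μ01) : Integrable f μ01 :=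
  hf.integrable (by norm_num)

lemma Ft_add {f g : ℝ → ℂ} (hf : MemLp f 2 μ01) (hg : MemLp g 2 μ01) (l : ℝ) :
    Ft (fun s => f s + g s) l = Ft f l + Ft g l := by
  unfold Ft
  rw [← integral_add (integrable_of_two (memLp_ee hf l)) (integrable_of_two (memLp_ee hg l))]
  congr 1; ext s; ring

lemma Ft_smul (f : ℝ → ℂ) (c : ℂ) (l : ℝ) :
    Ft (fun s => c * f s) l = c * Ft f l := by
  unfold Ft
  rw [← integral_const_mul]
  congr 1; ext s; ring

lemma Ft_sum {ι : Type*} (t : Finset ι) {f : ι → ℝ → ℂ} (hf : ∀ i, MemLp (f i) 2 μ01) (l : ℝ) :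
    Ft (fun s => ∑ i ∈ t, f i s) l = ∑ i ∈ t, Ft (f i) l := by
  unfold Ft
  rw [← integral_finsetSum _ (fun i _ => integrable_of_two (memLp_ee (hf i) l))]
  congr 1; ext s; rw [Finset.mul_sum]

lemma Ft_congr {f g : ℝ → ℂ} (h : f =ᵐ[μ01] g) (l : ℝ) : Ft f l = Ft g l := by
  unfold Ft
  apply integral_congr_ae
  filter_upwards [h] with s hs
  rw [hs]

lemma Ft_shift (f : ℝ → ℂ) (θ l : ℝ) :
    Ft (fun s : ℝ => Complex.exp (-(2 * θ * s : ℝ) * Complex.I) * f s) l = Ft f (θ + l) := by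
  unfold Ft
  congr 1; ext s
  rw [← mul_assoc, ← Complex.exp_add]
  congr 2; push_cast; ring

lemma parseval0 {f : ℝ → ℂ} (hf : MemLp f 2 μ01) :
    HasSum (fun n : ℤ => ‖Ft f (Real.pi * n)‖ ^ 2) (∫ s, ‖f s‖ ^ 2 ∂μ01) := by
  have e : volume.restrict (Ioc (0:ℝ) 1) = μ01 := by
    unfold μ01; exact (Measure.restrict_congr_set Ioo_ae_eq_Ioc).symm
  have h := hasSum_sq_fourierCoeffOn (f := f) (zero_lt_one) (by rw [e]; exact hf)
  convert! h using 1
  · ext n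
    rw [fourierCoeffOn_eq_integral, intervalIntegral.integral_of_le zero_le_one, e]
    simp only [sub_zero, div_one, one_smul, Ft]
    congr 2
    congr 1; ext s
    rw [smul_eq_mul, fourier_coe_apply]
    congr 2; push_cast; ring
  · rw [intervalIntegral.integral_of_le zero_le_one, e]; simp

lemma parseval {f : ℝ → ℂ} (hf : MemLp f 2 μ01) (θ : ℝ) :
    HasSum (fun n : ℤ => ‖Ft f (θ + Real.pi * n)‖ ^ 2) (∫ s, ‖f s‖ ^ 2 ∂μ01) := by
  have h := parseval0 (memLp_ee hf θ)
  simp only [Ft_shift, norm_mul, norm_ee, one_mul] at h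
  exact h

lemma Ft_bound {f : ℝ → ℂ} (hf : MemLp f 2 μ01) (l : ℝ) :
    ‖Ft f l‖ ^ 2 ≤ ∫ s, ‖f s‖ ^ 2 ∂μ01 := by
  have := le_hasSum (parseval hf l) 0 (fun _ _ => by positivity)
  simpa using this

/-! ### Small perturbations -/

lemma memLp_pow_mul {f : ℝ → ℂ} (hf : MemLp f 2 μ01) (k : ℕ) :
    MemLp (fun s : ℝ => (s : ℂ) ^ k * f s) 2 μ01 := by
  have hc : Continuous (fun s : ℝ => (s : ℂ) ^ k) := by fun_prop
  refine hf.of_le (hc.aestronglyMeasurable.mul hf.1) ?_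
  unfold μ01
  filter_upwards [ae_restrict_mem measurableSet_Ioo] with s hs
  rw [norm_mul, norm_pow, Complex.norm_real, Real.norm_of_nonneg hs.1.le]
  have : s ^ k ≤ 1 := pow_le_one₀ hs.1.le hs.2.le
  nlinarith [norm_nonneg (f s)]

lemma integral_pow_mul_le {f : ℝ → ℂ} (hf : MemLp f 2 μ01) (k : ℕ) :
    ∫ s, ‖(s : ℂ) ^ k * f s‖ ^ 2 ∂μ01 ≤ ∫ s, ‖f s‖ ^ 2 ∂μ01 := by
  refine integral_mono_ae ((memLp_two_iff_integrable_sq_norm (memLp_pow_mul hf k).1).1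
    (memLp_pow_mul hf k)) ((memLp_two_iff_integrable_sq_norm hf.1).1 hf) ?_
  unfold μ01
  filter_upwards [ae_restrict_mem measurableSet_Ioo] with s hs
  rw [norm_mul, norm_pow, Complex.norm_real, Real.norm_of_nonneg hs.1.le]
  have : s ^ k ≤ 1 := pow_le_one₀ hs.1.le hs.2.le
  have h0 : 0 ≤ s ^ k := pow_nonneg hs.1.le k
  have h1 : s ^ k * ‖f s‖ ≤ ‖f s‖ := by nlinarith [norm_nonneg (f s)]
  exact pow_le_pow_left₀ (by positivity) h1 2

lemma Ft_expand {f : ℝ → ℂ} (hf : MemLp f 2 μ01) (w d : ℝ) :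
    HasSum (fun k : ℕ => (-(2 * d : ℝ) * Complex.I) ^ k / (k.factorial : ℂ) *
      Ft (fun s : ℝ => (s : ℂ) ^ k * f s) w) (Ft f (w + d)) := by
  have hIntg : ∀ k : ℕ, Integrable (fun s : ℝ => (-(2 * d : ℝ) * Complex.I) ^ k / (k.factorial : ℂ) *
      (Complex.exp (-(2 * w * s : ℝ) * Complex.I) * ((s : ℂ) ^ k * f s))) μ01 := fun k =>
    (integrable_of_two (memLp_ee (memLp_pow_mul hf k) w)).const_mul _
  have hf1 := (integrable_of_two hf)
  have h := hasSum_integral_of_summable_integral_norm hIntg (by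
    refine Summable.of_nonneg_of_le (fun k => by positivity) (fun k => ?_)
      ((Real.summable_pow_div_factorial (2 * |d|)).mul_right (∫ s, ‖f s‖ ∂μ01))
    rw [← integral_const_mul]
    refine integral_mono_ae (hIntg k).norm (hf1.norm.const_mul _) ?_
    unfold μ01
    filter_upwards [ae_restrict_mem measurableSet_Ioo] with s hs
    rw [norm_mul, norm_mul, norm_ee, one_mul, norm_mul, norm_div, norm_pow, norm_mul,
      Complex.norm_I, mul_one, norm_neg, Complex.norm_real, norm_pow, Complex.norm_real,
      Real.norm_of_nonneg hs.1.le, Complex.norm_natCast, Real.norm_eq_abs, abs_mul, abs_two]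
    have : s ^ k ≤ 1 := pow_le_one₀ hs.1.le hs.2.le
    gcongr
    nlinarith [norm_nonneg (f s)])
  convert! h using 1
  · ext k
    rw [integral_const_mul]; rfl
  · unfold Ft
    congr 1; ext s
    have hs := NormedSpace.expSeries_div_hasSum_exp ((-(2 * d : ℝ) * Complex.I) * (s : ℂ))
    have h2 := (hs.mul_right (Complex.exp (-(2 * w * s : ℝ) * Complex.I) * f s)).tsum_eq
    rw [← Complex.exp_eq_exp_ℂ] at h2
    rw [show Complex.exp (-(2 * (w + d) * s : ℝ) * Complex.I) * f s
      = Complex.exp ((-(2 * d : ℝ) * Complex.I) * (s : ℂ)) *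
        (Complex.exp (-(2 * w * s : ℝ) * Complex.I) * f s) by
      rw [← mul_assoc, ← Complex.exp_add]; congr 2; push_cast; ring, ← h2]
    congr 1; ext k
    rw [mul_pow]; ring

lemma perturb {f : ℝ → ℂ} (hf : MemLp f 2 μ01) (θ δ : ℝ) (d : ℤ → ℝ) (t : Finset ℤ)
    (hd : ∀ n ∈ t, |d n| ≤ δ) :
    ∑ n ∈ t, ‖Ft f (θ + Real.pi * n + d n) - Ft f (θ + Real.pi * n)‖ ^ 2 ≤
      (Real.exp (2 * δ) - 1) ^ 2 * ∫ s, ‖f s‖ ^ 2 ∂μ01 := by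
  rcases t.eq_empty_or_nonempty with rfl | ⟨n0, hn0⟩
  · simp only [Finset.sum_empty]
    have : 0 ≤ ∫ s, ‖f s‖ ^ 2 ∂μ01 := integral_nonneg (fun s => by positivity)
    positivity
  have hδ : 0 ≤ δ := (abs_nonneg _).trans (hd n0 hn0)
  set F : ℝ := ∫ s, ‖f s‖ ^ 2 ∂μ01 with hF
  have hF0 : 0 ≤ F := integral_nonneg (fun s => by positivity)
  let X : ℕ → EuclideanSpace ℂ t := fun k => WithLp.toLp 2 fun n =>
    (-(2 * d n : ℝ) * Complex.I) ^ (k+1) / ((k+1).factorial : ℂ) *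
      Ft (fun s : ℝ => (s : ℂ) ^ (k+1) * f s) (θ + Real.pi * (n : ℤ))
  let Y : EuclideanSpace ℂ t := WithLp.toLp 2 fun n =>
    Ft f (θ + Real.pi * (n : ℤ) + d n) - Ft f (θ + Real.pi * (n : ℤ))
  have hXY : HasSum X Y := by
    have : HasSum (fun k => (EuclideanSpace.equiv t ℂ) (X k)) ((EuclideanSpace.equiv t ℂ) Y) := by
      rw [Pi.hasSum]
      intro n
      have h := Ft_expand hf (θ + Real.pi * (n : ℤ)) (d n)
      rw [← hasSum_nat_add_iff' 1] at h
      simpa [X, Y] using h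
    exact (EuclideanSpace.equiv t ℂ).hasSum.1 this
  have hX : ∀ k, ‖X k‖ ≤ (2 * δ) ^ (k+1) / ((k+1).factorial : ℝ) * Real.sqrt F := by
    intro k
    rw [EuclideanSpace.norm_eq]
    apply Real.sqrt_le_iff.2
    refine ⟨by positivity, ?_⟩
    rw [mul_pow, Real.sq_sqrt hF0]
    have h1 : ∀ n : t, ‖X k n‖ ^ 2 ≤ ((2 * δ) ^ (k+1) / ((k+1).factorial : ℝ)) ^ 2 *
        ‖Ft (fun s : ℝ => (s : ℂ) ^ (k+1) * f s) (θ + Real.pi * (n : ℤ))‖ ^ 2 := by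
      intro n
      rw [← mul_pow]
      simp only [X, norm_mul, norm_div, norm_pow, Complex.norm_I, mul_one, norm_neg,
        Complex.norm_real, Complex.norm_natCast, Real.norm_eq_abs, abs_two]
      gcongr
      exact hd n n.2
    refine (Finset.sum_le_sum fun n _ => h1 n).trans ?_
    rw [← Finset.mul_sum]
    gcongr
    refine le_trans ?_ (integral_pow_mul_le hf (k+1))
    rw [Finset.sum_coe_sort t
      (fun n => ‖Ft (fun s : ℝ => (s : ℂ) ^ (k+1) * f s) (θ + Real.pi * (n : ℤ))‖ ^ 2)]
    exact sum_le_hasSum t (fun _ _ => by positivity) (parseval (memLp_pow_mul hf (k+1)) θ)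
  have hs : HasSum (fun k : ℕ => (2 * δ) ^ (k+1) / ((k+1).factorial : ℝ) * Real.sqrt F)
      ((Real.exp (2 * δ) - 1) * Real.sqrt F) := by
    apply HasSum.mul_right
    have h := NormedSpace.expSeries_div_hasSum_exp (2 * δ)
    rw [← Real.exp_eq_exp_ℝ] at h
    rw [← hasSum_nat_add_iff' 1] at h
    simpa using h
  have hY := hXY.norm_le_of_bounded hs hX
  rw [EuclideanSpace.norm_eq] at hY
  have h2 := pow_le_pow_left₀ (Real.sqrt_nonneg _) hY 2
  rw [Real.sq_sqrt (by positivity), mul_pow, Real.sq_sqrt hF0] at h2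
  rw [Finset.sum_coe_sort t
      (fun n => ‖Ft f (θ + Real.pi * n + d n) - Ft f (θ + Real.pi * n)‖ ^ 2)] at h2
  exact h2

lemma kadec (lam : ℤ → ℝ)
    (hlam : Tendsto (fun n : ℤ => lam n - Real.pi * (n + 1/2)) cofinite (nhds 0)) :
    ∃ T0 : Finset ℤ, ∀ T : Finset ℤ, T0 ⊆ T → ∀ f : ℝ → ℂ, MemLp f 2 μ01 → ∀ B : ℝ,
      (∀ t : Finset ℤ, Disjoint t T → ∑ n ∈ t, ‖Ft f (lam n)‖ ^ 2 ≤ B) →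
      ∫ s, ‖f s‖ ^ 2 ∂μ01 ≤ 2 * ∑ n ∈ T, ‖Ft f (Real.pi / 2 + Real.pi * n)‖ ^ 2 + 4 * B := by
  have h1 : ∀ᶠ n in cofinite, |lam n - Real.pi * ((n : ℤ) + 1/2)| ≤ 1/8 := by
    have := (Metric.tendsto_nhds.1 hlam) (1/8) (by norm_num)
    filter_upwards [this] with n hn
    rw [Real.dist_eq, sub_zero] at hn
    exact hn.le
  rw [Filter.eventually_cofinite] at h1
  refine ⟨h1.toFinset, fun T hT f hf B hB => ?_⟩
  set F : ℝ := ∫ s, ‖f s‖ ^ 2 ∂μ01 with hF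
  have hF0 : 0 ≤ F := integral_nonneg (fun s => by positivity)
  have hexp : Real.exp (2 * (1/8)) - 1 ≤ 1/2 := by
    have := Real.exp_bound_div_one_sub_of_interval (x := 1/4) (by norm_num) (by norm_num)
    norm_num at this ⊢
    linarith
  have hexp0 : 0 ≤ Real.exp (2 * (1/8)) - 1 := by
    have := Real.add_one_le_exp (2 * (1/8) : ℝ); linarith
  have hexp2 : (Real.exp (2 * (1/8)) - 1) ^ 2 ≤ 1/4 := by nlinarith
  suffices h : F ≤ ∑ n ∈ T, ‖Ft f (Real.pi / 2 + Real.pi * n)‖ ^ 2 + 2 * B + F / 2 by linarith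
  refine hasSum_le_of_sum_le (parseval hf (Real.pi / 2)) (fun t => ?_)
  rw [← Finset.sum_inter_add_sum_sdiff t T]
  have ha : ∑ n ∈ t ∩ T, ‖Ft f (Real.pi / 2 + Real.pi * n)‖ ^ 2 ≤
      ∑ n ∈ T, ‖Ft f (Real.pi / 2 + Real.pi * n)‖ ^ 2 :=
    Finset.sum_le_sum_of_subset_of_nonneg Finset.inter_subset_right (fun _ _ _ => by positivity)
  have hb := perturb hf (Real.pi / 2) (1/8) (fun n => lam n - Real.pi * (n + 1/2)) (t \ T) (by
    intro n hn
    by_contra hc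
    exact (Finset.mem_sdiff.1 hn).2 (hT (by simpa using hc)))
  have hc := hB (t \ T) Finset.sdiff_disjoint
  have hd : ∑ n ∈ t \ T, ‖Ft f (Real.pi / 2 + Real.pi * n)‖ ^ 2 ≤
      2 * ∑ n ∈ t \ T, ‖Ft f (lam n)‖ ^ 2 + 2 * ∑ n ∈ t \ T,
      ‖Ft f (Real.pi / 2 + Real.pi * n + (lam n - Real.pi * (n + 1/2))) -
        Ft f (Real.pi / 2 + Real.pi * n)‖ ^ 2 := by
    rw [Finset.mul_sum, Finset.mul_sum, ← Finset.sum_add_distrib]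
    refine Finset.sum_le_sum fun n _ => ?_
    rw [show Real.pi / 2 + Real.pi * n + (lam n - Real.pi * (n + 1/2)) = lam n by ring]
    set a := Ft f (lam n)
    set b := Ft f (Real.pi / 2 + Real.pi * n)
    have : ‖b‖ ≤ ‖a‖ + ‖a - b‖ := by
      have := norm_sub_le a (a - b); rwa [sub_sub_cancel] at this
    nlinarith [norm_nonneg b, norm_nonneg a, norm_nonneg (a-b), sq_nonneg (‖a‖ - ‖a-b‖)]
  have he : (Real.exp (2 * (1/8)) - 1) ^ 2 * F ≤ 1/4 * F := by gcongr
  linarith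

/-! ### Division by a zero -/

def hdiv (f : ℝ → ℂ) (l : ℝ) (x : ℝ) : ℂ :=
  ∫ s, (if s < x then Complex.exp (-(2 * l * (s - x) : ℝ) * Complex.I) * f s else 0) ∂μ01

lemma hdiv_integrable {f : ℝ → ℂ} (hf : Integrable f μ01) (l z : ℝ) :
    Integrable (fun q : ℝ × ℝ => Complex.exp (-(2 * z * q.1 : ℝ) * Complex.I) *
      (if q.2 < q.1 then Complex.exp (-(2 * l * (q.2 - q.1) : ℝ) * Complex.I) * f q.2 else 0))
      (μ01.prod μ01) := by
  have h1 : Integrable (fun q : ℝ × ℝ => (1 : ℂ) * f q.2) (μ01.prod μ01) :=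
    (integrable_const (1:ℂ)).mul_prod hf
  simp only [one_mul] at h1
  have e : (fun q : ℝ × ℝ => Complex.exp (-(2 * z * q.1 : ℝ) * Complex.I) *
      (if q.2 < q.1 then Complex.exp (-(2 * l * (q.2 - q.1) : ℝ) * Complex.I) * f q.2 else 0)) =
      {q : ℝ × ℝ | q.2 < q.1}.indicator (fun q => (Complex.exp (-(2 * z * q.1 : ℝ) * Complex.I) *
        Complex.exp (-(2 * l * (q.2 - q.1) : ℝ) * Complex.I)) * f q.2) := by
    ext q
    by_cases h : q.2 < q.1
    · rw [Set.indicator_of_mem (by exact h), if_pos h]; ring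
    · rw [Set.indicator_of_notMem (by exact h), if_neg h, mul_zero]
  rw [e]
  refine Integrable.indicator ?_ (measurableSet_lt measurable_snd measurable_fst)
  refine h1.bdd_mul (c := 1) (Continuous.aestronglyMeasurable (by fun_prop)) ?_
  filter_upwards with q
  rw [norm_mul, norm_ee, norm_ee, one_mul]

lemma hdiv_memLp {f : ℝ → ℂ} (hf : MemLp f 2 μ01) (l : ℝ) : MemLp (hdiv f l) 2 μ01 := by
  have hf1 := integrable_of_two hf
  have h := (hdiv_integrable hf1 l 0).integral_prod_left
  have h1 : AEStronglyMeasurable (hdiv f l) μ01 := by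
    convert h.1 using 1
    ext x
    simp [hdiv]
  refine MemLp.of_bound h1 (∫ s, ‖f s‖ ∂μ01) ?_
  filter_upwards with x
  refine norm_integral_le_of_norm_le hf1.norm ?_
  filter_upwards with s
  split_ifs
  · rw [norm_mul, norm_ee, one_mul]
  · simp

lemma hdiv_inner (a s : ℝ) (hs : s ∈ Ioo (0:ℝ) 1) :
    2 * Complex.I * a * ∫ x, (if s < x then Complex.exp (-(2 * a * x : ℝ) * Complex.I) else 0) ∂μ01
      = Complex.exp (-(2 * a * s : ℝ) * Complex.I) - Complex.exp (-(2 * a : ℝ) * Complex.I) := by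
  have e : ∫ x, (if s < x then Complex.exp (-(2 * a * x : ℝ) * Complex.I) else 0) ∂μ01 =
      ∫ x in s..1, Complex.exp ((-(2 * a : ℝ) * Complex.I) * x) := by
    have : (fun x : ℝ => (if s < x then Complex.exp (-(2 * a * x : ℝ) * Complex.I) else 0)) =
      (Ioi s).indicator (fun x : ℝ => Complex.exp ((-(2 * a : ℝ) * Complex.I) * x)) := by
      ext x
      by_cases h : s < x
      · rw [Set.indicator_of_mem (by exact h), if_pos h]; congr 1; push_cast; ring
      · rw [Set.indicator_of_notMem (by exact h), if_neg h]
    rw [this, integral_indicator measurableSet_Ioi, μ01, Measure.restrict_restrict measurableSet_Ioi,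
      intervalIntegral.integral_of_le hs.2.le, integral_Ioc_eq_integral_Ioo]
    congr 2
    ext x
    constructor
    · rintro ⟨h1, h2⟩; exact ⟨h1, h2.2⟩
    · rintro ⟨h1, h2⟩; exact ⟨h1, hs.1.trans h1, h2⟩
  rw [e]
  by_cases ha : a = 0
  · subst ha; simp
  have hc : (-(2 * a : ℝ) * Complex.I) ≠ 0 := by
    simp [ha, Complex.I_ne_zero]
  rw [integral_exp_mul_complex hc]
  have : (2 * Complex.I * a) = -(-(2 * a : ℝ) * Complex.I) := by push_cast; ring
  rw [this, neg_mul, mul_div_cancel₀ _ hc, neg_sub]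
  congr 2 <;> push_cast <;> ring

lemma Ft_hdiv {f : ℝ → ℂ} (hf : MemLp f 2 μ01) (l z : ℝ) (h0 : Ft f l = 0) :
    2 * Complex.I * ((z - l : ℝ) : ℂ) * Ft (hdiv f l) z = Ft f z := by
  have hf1 := integrable_of_two hf
  have h1 : Ft (hdiv f l) z = ∫ s, ∫ x, Complex.exp (-(2 * z * x : ℝ) * Complex.I) *
      (if s < x then Complex.exp (-(2 * l * (s - x) : ℝ) * Complex.I) * f s else 0) ∂μ01 ∂μ01 := by
    rw [← integral_integral_swap (f := fun x s => Complex.exp (-(2 * z * x : ℝ) * Complex.I) *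
      (if s < x then Complex.exp (-(2 * l * (s - x) : ℝ) * Complex.I) * f s else 0))
      (hdiv_integrable hf1 l z)]
    unfold Ft hdiv
    congr 1; ext x
    rw [integral_const_mul]
  rw [h1, ← integral_const_mul]
  have h2 : Ft f z = ∫ s, (Complex.exp (-(2 * z * s : ℝ) * Complex.I) * f s -
      Complex.exp (-(2 * (z - l) : ℝ) * Complex.I) *
        (Complex.exp (-(2 * l * s : ℝ) * Complex.I) * f s)) ∂μ01 := by
    rw [integral_sub (integrable_of_two (memLp_ee hf z))
      ((integrable_of_two (memLp_ee hf l)).const_mul _), integral_const_mul]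
    change _ = Ft f z - _ * Ft f l
    rw [h0]; ring
  rw [h2]
  apply integral_congr_ae
  unfold μ01
  filter_upwards [ae_restrict_mem measurableSet_Ioo] with s hs
  have h3 := hdiv_inner (z - l) s hs
  have e : ∀ x : ℝ, Complex.exp (-(2 * z * x : ℝ) * Complex.I) *
      (if s < x then Complex.exp (-(2 * l * (s - x) : ℝ) * Complex.I) * f s else 0) =
      (Complex.exp (-(2 * l * s : ℝ) * Complex.I) * f s) *
      (if s < x then Complex.exp (-(2 * (z - l) * x : ℝ) * Complex.I) else 0) := by
    intro x
    split_ifs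
    · have e1 : Complex.exp (-(2 * z * x : ℝ) * Complex.I) *
          Complex.exp (-(2 * l * (s - x) : ℝ) * Complex.I) =
          Complex.exp (-(2 * l * s : ℝ) * Complex.I) *
          Complex.exp (-(2 * (z - l) * x : ℝ) * Complex.I) := by
        rw [← Complex.exp_add, ← Complex.exp_add]
        congr 1; push_cast; ring
      linear_combination f s * e1
    · simp
  simp only [e]
  rw [integral_const_mul, mul_left_comm]
  change _ * (2 * Complex.I * _ * ∫ x, _ ∂μ01) = _
  rw [h3, mul_sub, mul_right_comm, ← Complex.exp_add]
  congr 1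
  · congr 2; push_cast; ring
  · ring

/-! ### Completeness -/

lemma Ft_nonzero_infinite {f : ℝ → ℂ} (hf : MemLp f 2 μ01) (h : ∫ s, ‖f s‖ ^ 2 ∂μ01 ≠ 0) :
    ¬ {z : ℝ | Ft f z ≠ 0}.Countable := by
  intro hc
  have : (Set.univ : Set ℝ) ⊆ ⋃ n : ℤ, (fun θ : ℝ => θ + Real.pi * n) ⁻¹' {z : ℝ | Ft f z ≠ 0} := by
    intro θ _
    by_contra hθ
    simp only [mem_iUnion, mem_preimage, mem_ofPred_eq, not_exists, not_not] at hθ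
    have hp := parseval hf θ
    simp only [hθ, norm_zero] at hp
    apply h
    refine hp.unique ?_
    simp
  have h2 : (⋃ n : ℤ, (fun θ : ℝ => θ + Real.pi * n) ⁻¹' {z : ℝ | Ft f z ≠ 0}).Countable :=
    Set.countable_iUnion fun n => hc.preimage (add_left_injective _)
  exact Cardinal.not_countable_real (h2.mono this)

lemma rational_indep (T : Finset ℤ) (lam : ℤ → ℝ) (hinj : Function.Injective lam)
    (Z : Set ℝ) (hZ : Z.Infinite) (hZT : ∀ z ∈ Z, ∀ n ∈ T, z ≠ lam n)
    (c : ℂ) (d : ℤ → ℂ) (h : ∀ z ∈ Z, c + ∑ n ∈ T, d n / ((z : ℂ) - lam n) = 0) :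
    c = 0 ∧ ∀ n ∈ T, d n = 0 := by
  classical
  open Polynomial in
  let P : ℂ[X] := C c * ∏ n ∈ T, (X - C (lam n : ℂ)) +
    ∑ n ∈ T, C (d n) * ∏ m ∈ T.erase n, (X - C (lam m : ℂ))
  have hP : P = 0 := by
    refine Polynomial.eq_zero_of_infinite_isRoot P ?_
    refine (hZ.image (f := fun z : ℝ => (z : ℂ)) (Complex.ofReal_injective.injOn)).mono ?_
    rintro _ ⟨z, hz, rfl⟩
    have hz' : ∀ n ∈ T, (z : ℂ) - lam n ≠ 0 := fun n hn => by
      rw [sub_ne_zero]; exact_mod_cast hZT z hz n hn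
    have e : P.eval (z : ℂ) = (∏ n ∈ T, ((z : ℂ) - lam n)) *
        (c + ∑ n ∈ T, d n / ((z : ℂ) - lam n)) := by
      simp only [P, Polynomial.eval_add, Polynomial.eval_mul, Polynomial.eval_C,
        Polynomial.eval_prod, Polynomial.eval_sub, Polynomial.eval_X, Polynomial.eval_finsetSum]
      rw [mul_add, mul_comm c, Finset.mul_sum]
      congr 1
      refine Finset.sum_congr rfl fun n hn => ?_
      rw [← Finset.mul_prod_erase T _ hn]
      field_simp [hz' n hn]
    change P.eval (z : ℂ) = 0
    rw [e, h z hz, mul_zero]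
  have hd : ∀ n ∈ T, d n = 0 := by
    intro n hn
    have e := congrArg (Polynomial.eval (lam n : ℂ)) hP
    simp only [P, Polynomial.eval_add, Polynomial.eval_mul, Polynomial.eval_C,
        Polynomial.eval_prod, Polynomial.eval_sub, Polynomial.eval_X, Polynomial.eval_finsetSum,
        Polynomial.eval_zero] at e
    rw [Finset.prod_eq_zero (f := fun x => (lam n : ℂ) - lam x) hn (sub_self _), mul_zero, zero_add,
      Finset.sum_eq_single n] at e
    · rcases mul_eq_zero.1 e with h | h
      · exact h
      · exfalso
        rw [Finset.prod_eq_zero_iff] at h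
        obtain ⟨m, hm, hmn⟩ := h
        rw [sub_eq_zero] at hmn
        exact (Finset.mem_erase.1 hm).1 (hinj (by exact_mod_cast hmn.symm))
    · intro m hm hmn
      rw [Finset.prod_eq_zero (f := fun x => (lam n : ℂ) - lam x) (Finset.mem_erase.2 ⟨hmn.symm, hn⟩) (sub_self _), mul_zero]
    · intro h; exact absurd hn h
  refine ⟨?_, hd⟩
  obtain ⟨z, hz⟩ := hZ.nonempty
  have := h z hz
  rwa [Finset.sum_eq_zero (fun n hn => by rw [hd n hn, zero_div]), add_zero] at this

lemma complete (lam : ℤ → ℝ) (hinj : Function.Injective lam)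
    (hlam : Tendsto (fun n : ℤ => lam n - Real.pi * (n + 1/2)) cofinite (nhds 0))
    {f : ℝ → ℂ} (hf : MemLp f 2 μ01) (h0 : ∀ n, Ft f (lam n) = 0) :
    ∫ s, ‖f s‖ ^ 2 ∂μ01 = 0 := by
  classical
  by_contra hne
  obtain ⟨T, hT⟩ := kadec lam hlam
  replace hT := hT T subset_rfl
  let v : Option T → ℝ → ℂ := fun o => o.elim f (fun n => hdiv f (lam n))
  have hv : ∀ o, MemLp (v o) 2 μ01 := by
    rintro (_ | n)
    · exact hf
    · exact hdiv_memLp hf _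
  let Λ : (Option T → ℂ) →ₗ[ℂ] (T → ℂ) :=
    LinearMap.pi fun m => ∑ o, Ft (v o) (Real.pi / 2 + Real.pi * (m : ℤ)) • LinearMap.proj o
  have hker : LinearMap.ker Λ ≠ ⊥ := Λ.ker_ne_bot_of_finrank_lt (by simp)
  obtain ⟨c, hc, hc0⟩ := Submodule.exists_mem_ne_zero_of_ne_bot hker
  rw [LinearMap.mem_ker] at hc
  let g : ℝ → ℂ := fun s => ∑ o, c o * v o s
  have hgm : MemLp g 2 μ01 := memLp_finsetSum _ fun o _ => (hv o).const_mul (c o)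
  have hg : ∀ l, Ft g l = ∑ o, c o * Ft (v o) l := by
    intro l
    rw [Ft_sum _ (fun o => (hv o).const_mul (c o))]
    exact Finset.sum_congr rfl fun o _ => Ft_smul _ _ _
  have hgw : ∀ m ∈ T, Ft g (Real.pi / 2 + Real.pi * (m : ℤ)) = 0 := by
    intro m hm
    have := congrFun hc ⟨m, hm⟩
    simp only [Λ, LinearMap.pi_apply, LinearMap.coe_sum, Finset.sum_apply, LinearMap.smul_apply,
      LinearMap.proj_apply, smul_eq_mul, Pi.zero_apply] at this
    rw [hg, ← this]
    exact Finset.sum_congr rfl fun o _ => mul_comm _ _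
  have hdivz : ∀ (n : ℤ) (z : ℝ), z ≠ lam n → Ft (hdiv f (lam n)) z =
      Ft f z * ((1 / (2 * Complex.I)) / ((z : ℂ) - lam n)) := by
    intro n z hz
    have h := Ft_hdiv hf (lam n) z (h0 n)
    have hz' : (z : ℂ) - lam n ≠ 0 := by
      rw [sub_ne_zero]; exact_mod_cast hz
    rw [← h]
    push_cast
    field_simp [Complex.I_ne_zero]
  have hgl : ∀ n ∉ T, Ft g (lam n) = 0 := by
    intro n hn
    rw [hg, Fintype.sum_option]
    simp only [v, Option.elim_none, Option.elim_some]
    rw [h0, mul_zero, zero_add]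
    refine Finset.sum_eq_zero fun m _ => ?_
    rw [hdivz m _ (fun h => hn (by rw [hinj h]; exact m.2)), h0]
    ring
  have hg0 := hT g hgm 0 (fun t ht => by
    rw [Finset.sum_eq_zero]
    intro n hn
    rw [hgl n (Finset.disjoint_left.1 ht hn)]; simp)
  rw [Finset.sum_eq_zero (fun n hn => by rw [hgw n hn]; simp)] at hg0
  have hgz : ∀ z, Ft g z = 0 := by
    intro z
    have := Ft_bound hgm z
    have h2 : ‖Ft g z‖ ^ 2 ≤ 0 := by linarith
    have h3 : ‖Ft g z‖ ^ 2 = 0 := le_antisymm h2 (by positivity)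
    simpa using h3
  let d : ℤ → ℂ := fun n => if hn : n ∈ T then c (some ⟨n, hn⟩) * (1 / (2 * Complex.I)) else 0
  have key := rational_indep T lam hinj ({z : ℝ | Ft f z ≠ 0} \ (T.image lam : Finset ℝ)) (by
      intro hfin
      apply Ft_nonzero_infinite hf hne
      refine ((hfin.union (T.image lam).finite_toSet).countable).mono ?_
      intro z hz
      by_cases h : z ∈ ((T.image lam : Finset ℝ) : Set ℝ)
      · exact Or.inr h
      · exact Or.inl ⟨hz, h⟩) (by
      rintro z ⟨-, hz⟩ n hn rfl
      exact hz (by simpa using ⟨n, hn, rfl⟩)) (c none) d (by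
      rintro z ⟨hz, hzT⟩
      have hz' : ∀ n ∈ T, z ≠ lam n := by
        rintro n hn rfl
        exact hzT (by simpa using ⟨n, hn, rfl⟩)
      have h := hgz z
      rw [hg, Fintype.sum_option] at h
      simp only [v, Option.elim_none, Option.elim_some] at h
      rw [Finset.sum_congr rfl (fun (m : T) _ => by
        rw [hdivz m z (hz' m m.2)])] at h
      have e : ∑ n ∈ T, d n / ((z : ℂ) - lam n) = ∑ n : T, d n / ((z : ℂ) - lam n) :=
        (Finset.sum_coe_sort T (fun n => d n / ((z : ℂ) - lam n))).symm
      rw [e]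
      apply mul_left_cancel₀ hz
      rw [mul_zero, ← h, mul_add, mul_comm (c none), Finset.mul_sum]
      congr 1
      refine Finset.sum_congr rfl fun m _ => ?_
      simp only [d, m.2, dif_pos, Subtype.coe_eta]
      ring)
  apply hc0
  ext o
  rcases o with _ | m
  · exact key.1
  · have := key.2 m m.2
    simp only [d, m.2, dif_pos, Subtype.coe_eta] at this
    simpa using this

/-! ### Lower bound -/

lemma fc_tendsto (g : ℝ → ℂ) : Tendsto (fc g) cofinite (nhds 0) := by
  have h := (Real.tendsto_integral_exp_smul_cocompact ((Ioc (0:ℝ) 1).indicator g)).comp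
    Int.tendsto_coe_cofinite
  refine h.congr fun n => ?_
  simp only [Function.comp, fc]
  rw [intervalIntegral.integral_of_le zero_le_one, ← integral_indicator measurableSet_Ioc]
  congr 1; ext x
  by_cases hx : x ∈ Ioc (0:ℝ) 1
  · rw [Set.indicator_of_mem hx, Set.indicator_of_mem hx, Circle.smul_def, Real.fourierChar_apply,
      smul_eq_mul]
    congr 2; push_cast; ring
  · rw [Set.indicator_of_notMem hx, Set.indicator_of_notMem hx, smul_zero]

lemma lam_tendsto {p : ℝ≥0∞} {lam : ℤ → ℝ} (h : LamAsymp p lam) :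
    Tendsto (fun n : ℤ => lam n - Real.pi * (n + 1/2)) cofinite (nhds 0) := by
  obtain ⟨g, -, hg⟩ := h
  have h2 := (Complex.continuous_re.tendsto 0).comp (fc_tendsto g)
  refine h2.congr fun n => ?_
  have : ((lam n - Real.pi * (n + 1/2) : ℝ) : ℂ) = fc g n := by
    push_cast; rw [hg n]; ring
  simp only [Function.comp, ← this, Complex.ofReal_re]

lemma al_tendsto {p : ℝ≥0∞} {al : ℤ → ℝ} (h : AlAsymp p al) :
    Tendsto al cofinite (nhds 1) := by
  obtain ⟨g, -, hg⟩ := h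
  have h2 := ((Complex.continuous_re.tendsto 0).comp (fc_tendsto g)).const_add 1
  simp only [Complex.zero_re, add_zero] at h2
  refine h2.congr fun n => ?_
  have : ((al n - 1 : ℝ) : ℂ) = fc g n := by
    push_cast; rw [hg n]; ring
  simp only [Function.comp, ← this, Complex.ofReal_re]; ring

lemma Lp_norm_sq (x : Lp ℂ 2 μ01) : ‖x‖ ^ 2 = ∫ s, ‖x s‖ ^ 2 ∂μ01 := by
  have h := L2.inner_def (𝕜 := ℂ) x x
  rw [inner_self_eq_norm_sq_to_K] at h
  have e : (fun a => inner ℂ (x a) (x a)) = fun a => ((‖x a‖ ^ 2 : ℝ) : ℂ) := by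
    ext a; rw [inner_self_eq_norm_sq_to_K]; push_cast; rfl
  rw [e, integral_complex_ofReal] at h
  exact Complex.ofReal_injective (by rw [Complex.ofReal_pow]; exact h)

def Phi (l : ℝ) : Lp ℂ 2 μ01 →L[ℂ] ℂ :=
  LinearMap.mkContinuous
    { toFun := fun x => Ft x l
      map_add' := fun x y => by
        rw [← Ft_add (Lp.memLp x) (Lp.memLp y)]
        exact Ft_congr (Lp.coeFn_add x y) l
      map_smul' := fun c x => by
        rw [RingHom.id_apply, smul_eq_mul, ← Ft_smul]
        exact Ft_congr (Lp.coeFn_smul c x) l } 1 (fun x => by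
      rw [one_mul]
      refine abs_le_of_sq_le_sq' ?_ (norm_nonneg _) |>.2
      rw [Lp_norm_sq]
      exact Ft_bound (Lp.memLp x) l)

lemma Phi_apply (l : ℝ) (x : Lp ℂ 2 μ01) : Phi l x = Ft x l := rfl

lemma Phi_bound (l : ℝ) (x : Lp ℂ 2 μ01) : ‖Phi l x‖ ≤ ‖x‖ := by
  refine abs_le_of_sq_le_sq' ?_ (norm_nonneg _) |>.2
  rw [Lp_norm_sq]
  exact Ft_bound (Lp.memLp x) l

lemma lower_bound_Lp (lam al : ℤ → ℝ) (hinj : Function.Injective lam)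
    (hlam : Tendsto (fun n : ℤ => lam n - Real.pi * (n + 1/2)) cofinite (nhds 0))
    (hpos : ∀ n, 0 < al n) (hal : Tendsto al cofinite (nhds 1)) (x : ℕ → Lp ℂ 2 μ01)
    (hx1 : ∀ k, ‖x k‖ = 1)
    (hx : ∀ k (t : Finset ℤ), ∑ n ∈ t, al n * ‖Phi (lam n) (x k)‖ ^ 2 ≤ 1 / ((k:ℝ) + 1)) :
    False := by
  classical
  obtain ⟨T0, hT0⟩ := kadec lam hlam
  have hal2 : ∀ᶠ n in cofinite, 1/2 < al n := hal.eventually (lt_mem_nhds (by norm_num))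
  rw [Filter.eventually_cofinite] at hal2
  set T : Finset ℤ := T0 ∪ hal2.toFinset with hTdef
  have hT := hT0 T Finset.subset_union_left
  have halT : ∀ n ∉ T, 1/2 < al n := by
    intro n hn
    by_contra hc
    exact hn (Finset.mem_union_right _ (by simpa using hc))
  let Y : ℕ → (T → ℂ) := fun k m => Phi (Real.pi / 2 + Real.pi * (m : ℤ)) (x k)
  obtain ⟨a, -, φ, hφ, hYa⟩ := tendsto_subseq_of_bounded
    (Metric.isBounded_closedBall (x := (0 : T → ℂ)) (r := 1)) (x := Y) (by
      intro k
      rw [mem_closedBall_zero_iff, pi_norm_le_iff_of_nonneg zero_le_one]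
      intro m
      rw [← hx1 k]
      exact Phi_bound _ _)
  have heps : Tendsto (fun k => 1 / ((φ k : ℝ) + 1)) atTop (nhds 0) :=
    (tendsto_one_div_add_atTop_nhds_zero_nat (𝕜 := ℝ)).comp hφ.tendsto_atTop
  have hdist : ∀ j k, ‖x (φ j) - x (φ k)‖ ^ 2 ≤
      2 * ∑ m : T, ‖Y (φ j) m - Y (φ k) m‖ ^ 2 +
        16 * (1 / ((φ j : ℝ) + 1) + 1 / ((φ k : ℝ) + 1)) := by
    intro j k
    have h := hT (x (φ j) - x (φ k) : Lp ℂ 2 μ01) (Lp.memLp _)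
      (4 * (1 / ((φ j : ℝ) + 1) + 1 / ((φ k : ℝ) + 1))) (by
      intro t ht
      have e : ∀ n ∈ t, ‖Ft (x (φ j) - x (φ k) : Lp ℂ 2 μ01) (lam n)‖ ^ 2 ≤
          4 * (al n * ‖Phi (lam n) (x (φ j))‖ ^ 2 + al n * ‖Phi (lam n) (x (φ k))‖ ^ 2) := by
        intro n hn
        have h1 := halT n (Finset.disjoint_left.1 ht hn)
        rw [← Phi_apply, map_sub]
        set p := Phi (lam n) (x (φ j))
        set q := Phi (lam n) (x (φ k))
        have h2 := norm_sub_le p q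
        have h3 : ‖p - q‖ ^ 2 ≤ 2 * (‖p‖ ^ 2 + ‖q‖ ^ 2) := by
          nlinarith [norm_nonneg (p - q), sq_nonneg (‖p‖ - ‖q‖), norm_nonneg p, norm_nonneg q]
        have h4 : 0 ≤ ‖p‖ ^ 2 + ‖q‖ ^ 2 := by positivity
        nlinarith
      refine (Finset.sum_le_sum e).trans ?_
      rw [← Finset.mul_sum, Finset.sum_add_distrib]
      have := hx (φ j) t
      have := hx (φ k) t
      linarith)
    rw [← Lp_norm_sq] at h
    have e : ∑ n ∈ T, ‖Ft (x (φ j) - x (φ k) : Lp ℂ 2 μ01) (Real.pi / 2 + Real.pi * n)‖ ^ 2 =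
        ∑ m : T, ‖Y (φ j) m - Y (φ k) m‖ ^ 2 := by
      rw [← Finset.sum_coe_sort]
      refine Finset.sum_congr rfl fun m _ => ?_
      rw [← Phi_apply, map_sub]
    rw [e] at h
    linarith
  have hcau : CauchySeq (x ∘ φ) := by
    rw [cauchySeq_iff_tendsto_dist_atTop_0]
    have hlim : Tendsto (fun n : ℕ × ℕ => Real.sqrt (2 * ∑ m : T, ‖Y (φ n.1) m - Y (φ n.2) m‖ ^ 2 +
        16 * (1 / ((φ n.1 : ℝ) + 1) + 1 / ((φ n.2 : ℝ) + 1)))) atTop (nhds 0) := by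
      rw [← prod_atTop_atTop_eq]
      have h1 : ∀ m : T, Tendsto (fun n : ℕ × ℕ => ‖Y (φ n.1) m - Y (φ n.2) m‖ ^ 2)
          (atTop ×ˢ atTop) (nhds 0) := by
        intro m
        have hm : Tendsto (fun k => Y (φ k) m) atTop (nhds (a m)) := (tendsto_pi_nhds.1 hYa) m
        have := (((hm.comp tendsto_fst).sub (hm.comp tendsto_snd)
          : Tendsto _ (atTop ×ˢ atTop) _).norm).pow 2
        simpa using this
      have h2 := ((tendsto_finsetSum Finset.univ fun m _ => h1 m).const_mul 2).add
        (((heps.comp tendsto_fst).add (heps.comp tendsto_snd)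
          : Tendsto _ (atTop ×ˢ atTop) _).const_mul 16)
      have h3 := (Real.continuous_sqrt.tendsto _).comp h2
      simpa [Function.comp_def] using h3
    refine squeeze_zero (fun _ => dist_nonneg) (fun n => ?_) hlim
    rw [dist_eq_norm]
    exact Real.le_sqrt_of_sq_le (hdist n.1 n.2)
  obtain ⟨y, hy⟩ := cauchySeq_tendsto_of_complete hcau
  have hy1 : ‖y‖ = 1 := by
    refine tendsto_nhds_unique hy.norm ?_
    simp only [Function.comp, hx1]
    exact tendsto_const_nhds
  have hy0 : ∀ n, Ft y (lam n) = 0 := by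
    intro n
    have h1 : Tendsto (fun k => al n * ‖Phi (lam n) (x (φ k))‖ ^ 2) atTop
        (nhds (al n * ‖Phi (lam n) y‖ ^ 2)) :=
      ((((Phi (lam n)).continuous.tendsto y).comp hy).norm.pow 2).const_mul _
    have h2 := le_of_tendsto_of_tendsto' h1 heps (fun k => by
      simpa using hx (φ k) {n})
    have h3 := hpos n
    have h4 : ‖Phi (lam n) y‖ ^ 2 ≤ 0 := by
      by_contra hc
      push Not at hc
      nlinarith [mul_pos h3 hc]
    have h5 : ‖Phi (lam n) y‖ ^ 2 = 0 := le_antisymm h4 (by positivity)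
    rw [← Phi_apply]
    simpa using h5
  have := complete lam hinj hlam (Lp.memLp y) hy0
  rw [← Lp_norm_sq, hy1] at this
  norm_num at this

lemma lower_bound (lam al : ℤ → ℝ) (hinj : Function.Injective lam)
    (hlam : Tendsto (fun n : ℤ => lam n - Real.pi * (n + 1/2)) cofinite (nhds 0))
    (hpos : ∀ n, 0 < al n) (hal : Tendsto al cofinite (nhds 1)) :
    ∃ C > (0:ℝ), ∀ f : ℝ → ℂ, MemLp f 2 μ01 → ∀ B : ℝ,
      (∀ t : Finset ℤ, ∑ n ∈ t, al n * ‖Ft f (lam n)‖ ^ 2 ≤ B) →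
      C * ∫ s, ‖f s‖ ^ 2 ∂μ01 ≤ B := by
  by_contra! hcon
  have hcon' := fun k : ℕ => hcon (1 / ((k:ℝ) + 1)) (by positivity)
  choose f hf B hB hlt using hcon'
  let N : ℕ → ℝ := fun k => ∫ s, ‖f k s‖ ^ 2 ∂μ01
  have hN : ∀ k, 0 < N k := by
    intro k
    have h1 := hB k ∅
    rw [Finset.sum_empty] at h1
    have h2 := h1.trans_lt (hlt k)
    exact pos_of_mul_pos_right h2 (by positivity)
  let x : ℕ → Lp ℂ 2 μ01 := fun k => ((Real.sqrt (N k))⁻¹ : ℂ) • (hf k).toLp (f k)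
  have hnorm : ∀ k, ‖(hf k).toLp (f k)‖ = Real.sqrt (N k) := by
    intro k
    rw [← Real.sqrt_sq (norm_nonneg _), Lp_norm_sq]
    congr 1
    apply integral_congr_ae
    filter_upwards [(hf k).coeFn_toLp] with s hs
    rw [hs]
  refine lower_bound_Lp lam al hinj hlam hpos hal x (fun k => ?_) (fun k t => ?_)
  · have := Real.sqrt_pos.2 (hN k)
    rw [norm_smul, hnorm, norm_inv, Complex.norm_real, Real.norm_of_nonneg this.le]
    exact inv_mul_cancel₀ this.ne'
  · have h1 := (hB k t).trans (hlt k).le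
    have e : ∀ n, al n * ‖Phi (lam n) (x k)‖ ^ 2 = (N k)⁻¹ * (al n * ‖Ft (f k) (lam n)‖ ^ 2) := by
      intro n
      have h := Real.sqrt_nonneg (N k)
      simp only [x]
      rw [map_smul, Phi_apply, Ft_congr (hf k).coeFn_toLp, norm_smul, norm_inv, Complex.norm_real,
        Real.norm_of_nonneg h, mul_pow, inv_pow, Real.sq_sqrt (hN k).le]
      ring
    simp only [e]
    rw [← Finset.mul_sum, inv_mul_le_iff₀ (hN k), mul_comm (N k)]
    exact h1

/-! ### Convolution forms -/

lemma conv_real {k r : ℝ → ℝ} (hk : Integrable k) (hr : Integrable r) :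
    Integrable (fun q : ℝ × ℝ => k (q.1 - q.2) * r q.2) (volume.prod volume) ∧
    ∫ q : ℝ × ℝ, k (q.1 - q.2) * r q.2 ∂(volume.prod volume) = (∫ x, k x) * ∫ x, r x := by
  have h := Integrable.convolution_integrand (ContinuousLinearMap.mul ℝ ℝ) hr hk
  simp only [ContinuousLinearMap.mul_apply'] at h
  have h' : Integrable (fun q : ℝ × ℝ => k (q.1 - q.2) * r q.2) (volume.prod volume) := by
    refine h.congr ?_
    filter_upwards with q using mul_comm _ _
  refine ⟨h', ?_⟩
  rw [integral_prod_symm _ h']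
  simp only [integral_mul_const, integral_sub_right_eq_self]
  rw [integral_const_mul]

lemma conv_real' {k r : ℝ → ℝ} (hk : Integrable k) (hr : Integrable r) :
    Integrable (fun q : ℝ × ℝ => k (q.1 - q.2) * r q.1) (volume.prod volume) ∧
    ∫ q : ℝ × ℝ, k (q.1 - q.2) * r q.1 ∂(volume.prod volume) = (∫ x, k x) * ∫ x, r x := by
  obtain ⟨h1, h2⟩ := conv_real hk.comp_neg hr
  have e : (fun q : ℝ × ℝ => k (q.1 - q.2) * r q.1) =
      (fun q : ℝ × ℝ => k (-(q.1 - q.2)) * r q.2) ∘ Prod.swap := by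
    ext q; simp
  constructor
  · rw [e]; exact h1.swap
  · rw [e]
    refine (integral_prod_swap (fun q : ℝ × ℝ => k (-(q.1 - q.2)) * r q.2)).trans ?_
    rw [h2, integral_neg_eq_self]

lemma conv_form {k f g : ℝ → ℂ} (hk : Integrable k) (hf : MemLp f 2 volume)
    (hg : MemLp g 2 volume) :
    Integrable (fun q : ℝ × ℝ => k (q.1 - q.2) * f q.2 * star (g q.1)) (volume.prod volume) ∧
    ∫ q : ℝ × ℝ, ‖k (q.1 - q.2) * f q.2 * star (g q.1)‖ ∂(volume.prod volume) ≤
      (∫ x, ‖k x‖) * ((∫ x, ‖f x‖ ^ 2) + ∫ x, ‖g x‖ ^ 2) := by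
  have hf2 := (memLp_two_iff_integrable_sq_norm hf.1).1 hf
  have hg2 := (memLp_two_iff_integrable_sq_norm hg.1).1 hg
  obtain ⟨a1, a2⟩ := conv_real hk.norm hf2
  obtain ⟨b1, b2⟩ := conv_real' hk.norm hg2
  have hm : AEStronglyMeasurable (fun q : ℝ × ℝ => k (q.1 - q.2) * f q.2 * star (g q.1))
      (volume.prod volume) := by
    refine AEStronglyMeasurable.mul (AEStronglyMeasurable.mul ?_ hf.1.comp_snd) ?_
    · exact hk.1.comp_quasiMeasurePreserving (quasiMeasurePreserving_sub volume volume)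
    · exact hg.1.star.comp_fst
  have hle : ∀ q : ℝ × ℝ, ‖k (q.1 - q.2) * f q.2 * star (g q.1)‖ ≤
      ‖k (q.1 - q.2)‖ * ‖f q.2‖ ^ 2 + ‖k (q.1 - q.2)‖ * ‖g q.1‖ ^ 2 := by
    intro q
    rw [norm_mul, norm_mul, norm_star, ← mul_add, mul_assoc]
    gcongr
    nlinarith [sq_nonneg (‖f q.2‖ - ‖g q.1‖), norm_nonneg (f q.2), norm_nonneg (g q.1)]
  have hi : Integrable (fun q : ℝ × ℝ => k (q.1 - q.2) * f q.2 * star (g q.1))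
      (volume.prod volume) := by
    refine (a1.add b1).mono' hm ?_
    filter_upwards with q using hle q
  refine ⟨hi, ?_⟩
  refine (integral_mono hi.norm (a1.add b1) hle).trans ?_
  have := integral_add a1 b1
  simp only [Pi.add_apply]
  rw [this, a2, b2, mul_add]

def bet (k f g : ℝ → ℂ) : ℂ :=
  ∫ q : ℝ × ℝ, k (q.1 - q.2) * f q.2 * star (g q.1) ∂(μ01.prod μ01)

lemma conv_form01 {k f g : ℝ → ℂ} (hk : Integrable k μ11) (hf : MemLp f 2 μ01)
    (hg : MemLp g 2 μ01) :
    Integrable (fun q : ℝ × ℝ => k (q.1 - q.2) * f q.2 * star (g q.1)) (μ01.prod μ01) ∧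
    ‖bet k f g‖ ≤ (∫ x, ‖k x‖ ∂μ11) * ((∫ x, ‖f x‖ ^ 2 ∂μ01) + ∫ x, ‖g x‖ ^ 2 ∂μ01) := by
  have e : μ01.prod μ01 = (volume.prod volume).restrict (Ioo (0:ℝ) 1 ×ˢ Ioo (0:ℝ) 1) := by
    unfold μ01; rw [Measure.prod_restrict]
  have hms : MeasurableSet (Ioo (0:ℝ) 1 ×ˢ Ioo (0:ℝ) 1) := measurableSet_Ioo.prod measurableSet_Ioo
  have hk' : Integrable ((Ioo (-1:ℝ) 1).indicator k) := (integrable_indicator_iff measurableSet_Ioo).2 hk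
  have hf' : MemLp ((Ioo (0:ℝ) 1).indicator f) 2 volume :=
    (memLp_indicator_iff_restrict measurableSet_Ioo).2 hf
  have hg' : MemLp ((Ioo (0:ℝ) 1).indicator g) 2 volume :=
    (memLp_indicator_iff_restrict measurableSet_Ioo).2 hg
  obtain ⟨c1, c2⟩ := conv_form hk' hf' hg'
  have heq : ∀ q ∈ Ioo (0:ℝ) 1 ×ˢ Ioo (0:ℝ) 1, k (q.1 - q.2) * f q.2 * star (g q.1) =
      (Ioo (-1:ℝ) 1).indicator k (q.1 - q.2) * (Ioo (0:ℝ) 1).indicator f q.2 *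
        star ((Ioo (0:ℝ) 1).indicator g q.1) := by
    rintro ⟨x, s⟩ ⟨hx, hs⟩
    simp only at hx hs ⊢
    rw [Set.indicator_of_mem hx, Set.indicator_of_mem hs, Set.indicator_of_mem]
    exact ⟨by linarith [hx.1, hs.2], by linarith [hx.2, hs.1]⟩
  have heq' : ∀ᵐ q ∂((volume.prod volume).restrict (Ioo (0:ℝ) 1 ×ˢ Ioo (0:ℝ) 1)),
      k (q.1 - q.2) * f q.2 * star (g q.1) =
      (Ioo (-1:ℝ) 1).indicator k (q.1 - q.2) * (Ioo (0:ℝ) 1).indicator f q.2 *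
        star ((Ioo (0:ℝ) 1).indicator g q.1) := by
    filter_upwards [ae_restrict_mem hms] with q hq using heq q hq
  have hsq : ∀ h : ℝ → ℂ, ∫ x, ‖(Ioo (0:ℝ) 1).indicator h x‖ ^ 2 = ∫ x, ‖h x‖ ^ 2 ∂μ01 := by
    intro h
    unfold μ01
    rw [← integral_indicator measurableSet_Ioo]
    congr 1; ext x
    by_cases hx : x ∈ Ioo (0:ℝ) 1
    · rw [Set.indicator_of_mem hx, Set.indicator_of_mem hx]
    · rw [Set.indicator_of_notMem hx, Set.indicator_of_notMem hx]; simp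
  have hk1 : ∫ x, ‖(Ioo (-1:ℝ) 1).indicator k x‖ = ∫ x, ‖k x‖ ∂μ11 := by
    unfold μ11
    rw [← integral_indicator measurableSet_Ioo]
    congr 1; ext x
    rw [norm_indicator_eq_indicator_norm]
  rw [hsq, hsq, hk1] at c2
  constructor
  · rw [e]
    exact c1.restrict.congr (heq'.mono fun q hq => hq.symm)
  · unfold bet
    rw [e, integral_congr_ae heq']
    refine (norm_integral_le_integral_norm _).trans (le_trans ?_ c2)
    exact setIntegral_le_integral c1.norm (ae_of_all _ fun q => norm_nonneg _)

lemma bet_add {k k' f g : ℝ → ℂ} (hk : Integrable k μ11) (hk' : Integrable k' μ11)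
    (hf : MemLp f 2 μ01) (hg : MemLp g 2 μ01) :
    bet (fun s => k s + k' s) f g = bet k f g + bet k' f g := by
  unfold bet
  rw [← integral_add (conv_form01 hk hf hg).1 (conv_form01 hk' hf hg).1]
  congr 1; ext q; ring

lemma bet_smul (c : ℂ) (k f g : ℝ → ℂ) :
    bet (fun s => c * k s) f g = c * bet k f g := by
  unfold bet
  rw [← integral_const_mul]
  congr 1; ext q; ring

lemma bet_sum {ι : Type*} (t : Finset ι) {k : ι → ℝ → ℂ} {f g : ℝ → ℂ}
    (hk : ∀ i, Integrable (k i) μ11) (hf : MemLp f 2 μ01) (hg : MemLp g 2 μ01) :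
    bet (fun s => ∑ i ∈ t, k i s) f g = ∑ i ∈ t, bet (k i) f g := by
  unfold bet
  rw [← integral_finsetSum _ (fun i _ => (conv_form01 (hk i) hf hg).1)]
  congr 1; ext q; rw [Finset.sum_mul, Finset.sum_mul]

/-- The quadratic form of the convolution operator with kernel `K`. -/
def Bf (K : ℝ → M2) (u : ℝ → Fin 2 → ℂ) : ℂ :=
  ∑ i, ∑ j, bet (fun s => K s i j) (fun s => u s j) (fun s => u s i)

lemma comp_memLp {u : ℝ → Fin 2 → ℂ} {p : ℝ≥0∞} {μ : Measure ℝ} (hu : MemLp u p μ) (i : Fin 2) :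
    MemLp (fun s => u s i) p μ :=
  (ContinuousLinearMap.proj (R := ℂ) (φ := fun _ : Fin 2 => ℂ) i).comp_memLp' hu

def entryL (i j : Fin 2) : M2 →L[ℂ] ℂ :=
  LinearMap.toContinuousLinearMap (Matrix.entryLinearMap ℂ ℂ i j)

lemma entryL_apply (i j : Fin 2) (A : M2) : entryL i j A = A i j := rfl

lemma entry_integrable {K : ℝ → M2} (hK : Integrable K μ11) (i j : Fin 2) :
    Integrable (fun s => K s i j) μ11 := (entryL i j).integrable_comp hK

lemma Bf_add {K K' : ℝ → M2} (hK : Integrable K μ11) (hK' : Integrable K' μ11)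
    {u : ℝ → Fin 2 → ℂ} (hu : MemLp u 2 μ01) :
    Bf (fun s => K s + K' s) u = Bf K u + Bf K' u := by
  unfold Bf
  simp only [Matrix.add_apply, ← Finset.sum_add_distrib]
  refine Finset.sum_congr rfl fun i _ => Finset.sum_congr rfl fun j _ => ?_
  exact bet_add (entry_integrable hK i j) (entry_integrable hK' i j) (comp_memLp hu j)
    (comp_memLp hu i)

lemma Bf_smul (c : ℂ) (K : ℝ → M2) (u : ℝ → Fin 2 → ℂ) :
    Bf (fun s => c • K s) u = c * Bf K u := by
  unfold Bf
  simp only [Matrix.smul_apply, smul_eq_mul, Finset.mul_sum]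
  refine Finset.sum_congr rfl fun i _ => Finset.sum_congr rfl fun j _ => ?_
  exact bet_smul _ _ _ _

lemma Bf_sub {K K' : ℝ → M2} (hK : Integrable K μ11) (hK' : Integrable K' μ11)
    {u : ℝ → Fin 2 → ℂ} (hu : MemLp u 2 μ01) :
    Bf (fun s => K s - K' s) u = Bf K u - Bf K' u := by
  have h := Bf_add hK (hK'.smul (-1 : ℂ)) hu
  have h2 := Bf_smul (-1) K' u
  have e : (fun s => K s - K' s) = fun s => K s + ((-1 : ℂ) • K') s := by
    ext1 s; simp [sub_eq_add_neg]
  rw [e, h]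
  change _ + Bf (fun s => (-1 : ℂ) • K' s) u = _
  rw [h2]; ring

lemma Bf_sum {ι : Type*} (t : Finset ι) {K : ι → ℝ → M2} (hK : ∀ i, Integrable (K i) μ11)
    {u : ℝ → Fin 2 → ℂ} (hu : MemLp u 2 μ01) :
    Bf (fun s => ∑ i ∈ t, K i s) u = ∑ i ∈ t, Bf (K i) u := by
  classical
  induction t using Finset.induction_on with
  | empty => simp [Bf, bet]
  | insert a t ha ih =>
    simp only [Finset.sum_insert ha]
    rw [Bf_add (hK a) (integrable_finsetSum t fun i _ => hK i) hu, ih]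

lemma Bf_bound {u : ℝ → Fin 2 → ℂ} (hu : MemLp u 2 μ01) :
    ∃ C : ℝ, ∀ K : ℝ → M2, Integrable K μ11 → ‖Bf K u‖ ≤ C * ∫ s, ‖K s‖ ∂μ11 := by
  refine ⟨∑ i, ∑ j, ‖entryL i j‖ * ((∫ x, ‖u x j‖ ^ 2 ∂μ01) + ∫ x, ‖u x i‖ ^ 2 ∂μ01),
    fun K hK => ?_⟩
  unfold Bf
  rw [Finset.sum_mul]
  refine norm_sum_le_of_le _ fun i _ => ?_
  rw [Finset.sum_mul]
  refine norm_sum_le_of_le _ fun j _ => ?_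
  refine (conv_form01 (entry_integrable hK i j) (comp_memLp hu j) (comp_memLp hu i)).2.trans ?_
  have h1 : ∫ x, ‖K x i j‖ ∂μ11 ≤ ‖entryL i j‖ * ∫ s, ‖K s‖ ∂μ11 := by
    rw [← integral_const_mul]
    refine integral_mono (entry_integrable hK i j).norm (hK.norm.const_mul _) fun s => ?_
    exact (entryL i j).le_opNorm (K s)
  have h2 : 0 ≤ (∫ x, ‖u x j‖ ^ 2 ∂μ01) + ∫ x, ‖u x i‖ ^ 2 ∂μ01 :=
    add_nonneg (integral_nonneg fun _ => by positivity) (integral_nonneg fun _ => by positivity)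
  calc _ ≤ (‖entryL i j‖ * ∫ s, ‖K s‖ ∂μ11) * ((∫ x, ‖u x j‖ ^ 2 ∂μ01) + ∫ x, ‖u x i‖ ^ 2 ∂μ01) := by
        gcongr
    _ = _ := by ring

lemma form_eq {K : ℝ → M2} (hK : Integrable K μ11) {u : ℝ → Fin 2 → ℂ} (hu : MemLp u 2 μ01) :
    ∫ x, ip2 (u x + ∫ s, (K (x - s)).mulVec (u s) ∂μ01) (u x) ∂μ01 =
      ((∫ x, (‖u x 0‖ ^ 2 + ‖u x 1‖ ^ 2) ∂μ01 : ℝ) : ℂ) + Bf K u := by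
  have hone : MemLp (fun _ : ℝ => (1 : ℂ)) 2 μ01 := memLp_const 1
  -- a.e. integrability of the slices
  have hsl : ∀ i j, ∀ᵐ x ∂μ01, Integrable (fun s => K (x - s) i j * u s j) μ01 := by
    intro i j
    have h := (conv_form01 (entry_integrable hK i j) (comp_memLp hu j) hone).1.prod_right_ae
    simpa using h
  have hIntg : ∀ i j, Integrable (fun x => (∫ s, K (x - s) i j * u s j ∂μ01) * star (u x i)) μ01 := by
    intro i j
    have h := (conv_form01 (entry_integrable hK i j) (comp_memLp hu j)
      (comp_memLp hu i)).1.integral_prod_left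
    simpa only [integral_mul_const] using h
  have hbet : ∀ i j, ∫ x, (∫ s, K (x - s) i j * u s j ∂μ01) * star (u x i) ∂μ01 =
      bet (fun s => K s i j) (fun s => u s j) (fun s => u s i) := by
    intro i j
    unfold bet
    rw [integral_prod _ (conv_form01 (entry_integrable hK i j) (comp_memLp hu j)
      (comp_memLp hu i)).1]
    simp only [integral_mul_const]
  have hae : ∀ᵐ x ∂μ01, ip2 (u x + ∫ s, (K (x - s)).mulVec (u s) ∂μ01) (u x) =
      ((‖u x 0‖ ^ 2 + ‖u x 1‖ ^ 2 : ℝ) : ℂ) +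
      ∑ i, ∑ j, (∫ s, K (x - s) i j * u s j ∂μ01) * star (u x i) := by
    filter_upwards [hsl 0 0, hsl 0 1, hsl 1 0, hsl 1 1] with x h00 h01 h10 h11
    have hI : ∀ i, Integrable (fun s => (K (x - s)).mulVec (u s) i) μ01 := by
      intro i
      fin_cases i
      · refine (h00.add h01).congr (ae_of_all _ fun s => ?_)
        simp [Matrix.mulVec, dotProduct, Fin.sum_univ_two]
      · refine (h10.add h11).congr (ae_of_all _ fun s => ?_)
        simp [Matrix.mulVec, dotProduct, Fin.sum_univ_two]
    have e0 : (∫ s, (K (x - s)).mulVec (u s) ∂μ01) 0 =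
        (∫ s, K (x - s) 0 0 * u s 0 ∂μ01) + ∫ s, K (x - s) 0 1 * u s 1 ∂μ01 := by
      rw [eval_integral hI, ← integral_add h00 h01]
      simp [Matrix.mulVec, dotProduct, Fin.sum_univ_two]
    have e1 : (∫ s, (K (x - s)).mulVec (u s) ∂μ01) 1 =
        (∫ s, K (x - s) 1 0 * u s 0 ∂μ01) + ∫ s, K (x - s) 1 1 * u s 1 ∂μ01 := by
      rw [eval_integral hI, ← integral_add h10 h11]
      simp [Matrix.mulVec, dotProduct, Fin.sum_univ_two]
    have n : ∀ z : ℂ, ((‖z‖ ^ 2 : ℝ) : ℂ) = z * star z := by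
      intro z
      rw [Complex.star_def, Complex.mul_conj, Complex.normSq_eq_norm_sq]
    rw [Complex.ofReal_add, n, n]
    simp only [ip2, Pi.add_apply, e0, e1, Fin.sum_univ_two]
    ring
  have hsq : ∀ i, Integrable (fun x => ‖u x i‖ ^ 2) μ01 := fun i =>
    (memLp_two_iff_integrable_sq_norm (comp_memLp hu i).1).1 (comp_memLp hu i)
  have hsum : Integrable (fun x => ∑ i, ∑ j, (∫ s, K (x - s) i j * u s j ∂μ01) * star (u x i)) μ01 :=
    integrable_finsetSum _ fun i _ => integrable_finsetSum _ fun j _ => hIntg i j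
  have hre : Integrable (fun x => ((‖u x 0‖ ^ 2 + ‖u x 1‖ ^ 2 : ℝ) : ℂ)) μ01 :=
    ((hsq 0).add (hsq 1)).ofReal
  rw [integral_congr_ae hae, integral_add hre hsum, integral_complex_ofReal]
  congr 1
  rw [integral_finsetSum _ fun i _ => integrable_finsetSum _ fun j _ => hIntg i j]
  unfold Bf
  refine Finset.sum_congr rfl fun i _ => ?_
  rw [integral_finsetSum _ fun j _ => hIntg i j]
  exact Finset.sum_congr rfl fun j _ => hbet i j

/-! ### The kernels `expB` and the final estimates -/

/-- `u₁ + i u₂`. -/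
def uf (u : ℝ → Fin 2 → ℂ) (s : ℝ) : ℂ := u s 0 + Complex.I * u s 1

/-- The conjugate of `u₁ - i u₂`. -/
def ug (u : ℝ → Fin 2 → ℂ) (s : ℝ) : ℂ := star (u s 0 - Complex.I * u s 1)

lemma uf_memLp {u : ℝ → Fin 2 → ℂ} (hu : MemLp u 2 μ01) : MemLp (uf u) 2 μ01 :=
  (comp_memLp hu 0).add ((comp_memLp hu 1).const_mul Complex.I)

lemma ug_memLp {u : ℝ → Fin 2 → ℂ} (hu : MemLp u 2 μ01) : MemLp (ug u) 2 μ01 :=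
  ((comp_memLp hu 0).sub ((comp_memLp hu 1).const_mul Complex.I)).star

lemma n_sq (z : ℂ) : ((‖z‖ ^ 2 : ℝ) : ℂ) = z * star z := by
  rw [Complex.star_def, Complex.mul_conj, Complex.normSq_eq_norm_sq]

lemma uf_ug_sq (u : ℝ → Fin 2 → ℂ) (s : ℝ) :
    ‖uf u s‖ ^ 2 + ‖ug u s‖ ^ 2 = 2 * (‖u s 0‖ ^ 2 + ‖u s 1‖ ^ 2) := by
  have h := parallelogram_law_with_norm ℝ (u s 0) (Complex.I * u s 1)
  unfold uf ug
  rw [norm_star]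
  rw [norm_mul, Complex.norm_I, one_mul] at h
  nlinarith [h]

lemma sq_integrable {f : ℝ → ℂ} (hf : MemLp f 2 μ01) : Integrable (fun s => ‖f s‖ ^ 2) μ01 :=
  (memLp_two_iff_integrable_sq_norm hf.1).1 hf

lemma uf_ug_int {u : ℝ → Fin 2 → ℂ} (hu : MemLp u 2 μ01) :
    (∫ s, ‖uf u s‖ ^ 2 ∂μ01) + ∫ s, ‖ug u s‖ ^ 2 ∂μ01 =
      2 * ∫ s, (‖u s 0‖ ^ 2 + ‖u s 1‖ ^ 2) ∂μ01 := by
  rw [← integral_add (sq_integrable (uf_memLp hu)) (sq_integrable (ug_memLp hu)),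
    ← integral_const_mul]
  congr 1; ext s; exact uf_ug_sq u s

lemma expB_cont (c : ℂ) : Continuous (fun s : ℝ => expB (c * (s : ℂ))) := by
  unfold expB; fun_prop

lemma expB_integrable (c : ℂ) : Integrable (fun s : ℝ => expB (c * (s : ℂ))) μ11 := by
  unfold μ11
  exact ((expB_cont c).integrableOn_Icc).mono_set Ioo_subset_Icc_self

lemma expB_ident (l x s : ℝ) (u : ℝ → Fin 2 → ℂ) :
    ∑ i, ∑ j, expB (2 * (l:ℂ) * ((x - s : ℝ) : ℂ)) i j * u s j * star (u x i) =
    (1/2 : ℂ) * (star (Complex.exp (-(2 * l * x : ℝ) * Complex.I) * uf u x) *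
        (Complex.exp (-(2 * l * s : ℝ) * Complex.I) * uf u s)) +
    (1/2 : ℂ) * ((Complex.exp (-(2 * l * x : ℝ) * Complex.I) * ug u x) *
        star (Complex.exp (-(2 * l * s : ℝ) * Complex.I) * ug u s)) := by
  have hst : ∀ y : ℝ, star (Complex.exp (-(2 * l * y : ℝ) * Complex.I)) =
      Complex.exp ((2 * l * y : ℝ) * Complex.I) := by
    intro y
    rw [Complex.star_def, ← Complex.exp_conj]
    congr 1
    simp only [map_mul, map_neg, Complex.conj_I, Complex.conj_ofReal]
    ring
  have h1 : Complex.exp (2 * (l:ℂ) * ((x - s : ℝ) : ℂ) * Complex.I) =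
      Complex.exp ((2 * l * x : ℝ) * Complex.I) * Complex.exp (-(2 * l * s : ℝ) * Complex.I) := by
    rw [← Complex.exp_add]; congr 1; push_cast; ring
  have h2 : Complex.exp (-(2 * (l:ℂ) * ((x - s : ℝ) : ℂ)) * Complex.I) =
      Complex.exp (-(2 * l * x : ℝ) * Complex.I) * Complex.exp ((2 * l * s : ℝ) * Complex.I) := by
    rw [← Complex.exp_add]; congr 1; push_cast; ring
  simp only [expB, Fin.sum_univ_two, Matrix.of_apply, Matrix.cons_val', Matrix.cons_val_zero,
    Matrix.cons_val_one, Matrix.cons_val_fin_one, Complex.cos, Complex.sin, h1, h2, star_mul',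
    hst, uf, ug, star_add, star_sub, star_star]
  rw [show star Complex.I = -Complex.I from Complex.conj_I]
  generalize Complex.exp ((2 * l * x : ℝ) * Complex.I) = a
  generalize Complex.exp (-(2 * l * x : ℝ) * Complex.I) = a'
  generalize Complex.exp ((2 * l * s : ℝ) * Complex.I) = b
  generalize Complex.exp (-(2 * l * s : ℝ) * Complex.I) = b'
  generalize u s 0 = p
  generalize u s 1 = q
  generalize star (u x 0) = p'
  generalize star (u x 1) = q'
  linear_combination (1/2 : ℂ) * (a * b' + a' * b) * q * q' * Complex.I_sq

/-- The value of the form for the kernel `expB (2 l s)`. -/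
def Ph (u : ℝ → Fin 2 → ℂ) (l : ℝ) : ℝ := 1/2 * (‖Ft (uf u) l‖ ^ 2 + ‖Ft (ug u) l‖ ^ 2)

lemma Ph_nonneg (u : ℝ → Fin 2 → ℂ) (l : ℝ) : 0 ≤ Ph u l := by unfold Ph; positivity

lemma Bf_expB {u : ℝ → Fin 2 → ℂ} (hu : MemLp u 2 μ01) (l : ℝ) :
    Bf (fun s : ℝ => expB (2 * (l:ℂ) * (s:ℂ))) u = (Ph u l : ℂ) := by
  have hi : ∀ i j, Integrable (fun q : ℝ × ℝ =>
      expB (2 * (l:ℂ) * ((q.1 - q.2 : ℝ) : ℂ)) i j * u q.2 j * star (u q.1 i)) (μ01.prod μ01) :=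
    fun i j => (conv_form01 (entry_integrable (expB_integrable (2 * (l:ℂ))) i j)
      (comp_memLp hu j) (comp_memLp hu i)).1
  have hF := integrable_of_two (memLp_ee (uf_memLp hu) l)
  have hG := integrable_of_two (memLp_ee (ug_memLp hu) l)
  have hF' : Integrable (fun s : ℝ => star (Complex.exp (-(2 * l * s : ℝ) * Complex.I) * uf u s)) μ01 :=
    integrable_of_two (memLp_ee (uf_memLp hu) l).star
  have hG' : Integrable (fun s : ℝ => star (Complex.exp (-(2 * l * s : ℝ) * Complex.I) * ug u s)) μ01 :=
    integrable_of_two (memLp_ee (ug_memLp hu) l).star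
  have e : Bf (fun s : ℝ => expB (2 * (l:ℂ) * (s:ℂ))) u =
      ∫ q : ℝ × ℝ, ∑ i, ∑ j,
        expB (2 * (l:ℂ) * ((q.1 - q.2 : ℝ) : ℂ)) i j * u q.2 j * star (u q.1 i)
        ∂(μ01.prod μ01) := by
    rw [integral_finsetSum _ fun i _ => integrable_finsetSum _ fun j _ => hi i j]
    unfold Bf
    refine Finset.sum_congr rfl fun i _ => ?_
    rw [integral_finsetSum _ fun j _ => hi i j]
    rfl
  rw [e]
  simp only [expB_ident]
  rw [integral_add ((hF'.mul_prod hF).const_mul _) ((hG.mul_prod hG').const_mul _),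
    integral_const_mul, integral_const_mul, integral_prod_mul
      (fun x : ℝ => star (Complex.exp (-(2 * l * x : ℝ) * Complex.I) * uf u x))
      (fun s : ℝ => Complex.exp (-(2 * l * s : ℝ) * Complex.I) * uf u s),
    integral_prod_mul
      (fun x : ℝ => Complex.exp (-(2 * l * x : ℝ) * Complex.I) * ug u x)
      (fun s : ℝ => star (Complex.exp (-(2 * l * s : ℝ) * Complex.I) * ug u s))]
  have hc : ∀ f : ℝ → ℂ, ∫ x, star (f x) ∂μ01 = star (∫ x, f x ∂μ01) := fun f => integral_conj
  rw [hc, hc]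
  unfold Ph
  rw [Complex.ofReal_mul, Complex.ofReal_add, n_sq, n_sq]
  unfold Ft
  push_cast
  ring

/-- The general term of the series. -/
def Dn (lam al : ℤ → ℝ) (n : ℤ) (s : ℝ) : M2 :=
  (al n : ℂ) • expB (2 * (lam n : ℂ) * (s : ℂ)) - expB (Real.pi * (2 * (n : ℂ) + 1) * (s : ℂ))

lemma Dn_integrable (lam al : ℤ → ℝ) (n : ℤ) : Integrable (Dn lam al n) μ11 :=
  ((expB_integrable _).smul (al n : ℂ)).sub (expB_integrable _)

lemma Bf_Dn (lam al : ℤ → ℝ) {u : ℝ → Fin 2 → ℂ} (hu : MemLp u 2 μ01) (n : ℤ) :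
    Bf (Dn lam al n) u = ((al n * Ph u (lam n) - Ph u (Real.pi / 2 + Real.pi * n) : ℝ) : ℂ) := by
  have h := Bf_sub ((expB_integrable (2 * (lam n : ℂ))).smul (al n : ℂ))
    (expB_integrable (Real.pi * (2 * (n : ℂ) + 1))) hu
  have e : Bf (Dn lam al n) u = Bf ((al n : ℂ) • fun s : ℝ => expB (2 * (lam n : ℂ) * (s : ℂ))) u -
      Bf (fun s : ℝ => expB (Real.pi * (2 * (n : ℂ) + 1) * (s : ℂ))) u := h
  have e2 : Bf ((al n : ℂ) • fun s : ℝ => expB (2 * (lam n : ℂ) * (s : ℂ))) u =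
      (al n : ℂ) * Bf (fun s : ℝ => expB (2 * (lam n : ℂ) * (s : ℂ))) u := Bf_smul _ _ _
  have e3 : (fun s : ℝ => expB (Real.pi * (2 * (n : ℂ) + 1) * (s : ℂ))) =
      fun s : ℝ => expB (2 * ((Real.pi / 2 + Real.pi * n : ℝ) : ℂ) * (s : ℂ)) := by
    ext1 s; congr 1; push_cast; ring
  rw [e, e2, e3, Bf_expB hu, Bf_expB hu]
  push_cast; ring

lemma Ph_bessel {u : ℝ → Fin 2 → ℂ} (hu : MemLp u 2 μ01) (t : Finset ℤ) :
    ∑ n ∈ t, Ph u (Real.pi / 2 + Real.pi * n) ≤ ∫ s, (‖u s 0‖ ^ 2 + ‖u s 1‖ ^ 2) ∂μ01 := by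
  have h1 := sum_le_hasSum t (fun _ _ => by positivity) (parseval (uf_memLp hu) (Real.pi / 2))
  have h2 := sum_le_hasSum t (fun _ _ => by positivity) (parseval (ug_memLp hu) (Real.pi / 2))
  have h3 := uf_ug_int hu
  unfold Ph
  rw [← Finset.mul_sum, Finset.sum_add_distrib]
  linarith

lemma partial_lower {lam al : ℤ → ℝ} (hpos : ∀ n, 0 < al n) {u : ℝ → Fin 2 → ℂ}
    (hu : MemLp u 2 μ01) {t t' : Finset ℤ} (ht : t ⊆ t') :
    ∑ n ∈ t, al n * Ph u (lam n) ≤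
      (∫ s, (‖u s 0‖ ^ 2 + ‖u s 1‖ ^ 2) ∂μ01) + (Bf (fun s => ∑ n ∈ t', Dn lam al n s) u).re := by
  rw [Bf_sum t' (Dn_integrable lam al) hu]
  simp only [Bf_Dn lam al hu]
  rw [← Complex.ofReal_sum, Complex.ofReal_re, Finset.sum_sub_distrib]
  have h1 := Ph_bessel hu t'
  have h2 : ∑ n ∈ t, al n * Ph u (lam n) ≤ ∑ n ∈ t', al n * Ph u (lam n) :=
    Finset.sum_le_sum_of_subset_of_nonneg ht fun n _ _ =>
      mul_nonneg (hpos n).le (Ph_nonneg u _)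
  linarith

lemma Bf_tendsto {u : ℝ → Fin 2 → ℂ} (hu : MemLp u 2 μ01) {G : ℕ → ℝ → M2} {H : ℝ → M2}
    (hG : ∀ N, Integrable (G N) μ11) (hH : Integrable H μ11)
    (h : Tendsto (fun N => eLpNorm (fun s => G N s - H s) 1 μ11) atTop (nhds 0)) :
    Tendsto (fun N => Bf (G N) u) atTop (nhds (Bf H u)) := by
  obtain ⟨C, hC⟩ := Bf_bound hu
  rw [tendsto_iff_norm_sub_tendsto_zero]
  have h2 : Tendsto (fun N => C * (eLpNorm (fun s => G N s - H s) 1 μ11).toReal) atTop (nhds 0) := by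
    have := ((ENNReal.tendsto_toReal ENNReal.zero_ne_top).comp h).const_mul C
    simpa using this
  refine squeeze_zero (fun _ => norm_nonneg _) (fun N => ?_) h2
  rw [← Bf_sub (hG N) hH hu]
  refine (hC _ ((hG N).sub hH)).trans_eq ?_
  rw [integral_norm_eq_lintegral_enorm ((hG N).sub hH).1, eLpNorm_one_eq_lintegral_enorm]
  rfl

lemma form_lower {p : ℝ≥0∞} (hp : 1 ≤ p) {lam al : ℤ → ℝ} (hpos : ∀ n, 0 < al n)
    {H : ℝ → M2} (hH : IsHSum p lam al H) {u : ℝ → Fin 2 → ℂ} (hu : MemLp u 2 μ01)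
    (t : Finset ℤ) :
    ∑ n ∈ t, al n * Ph u (lam n) ≤
      (∫ s, (‖u s 0‖ ^ 2 + ‖u s 1‖ ^ 2) ∂μ01) + (Bf H u).re := by
  obtain ⟨hm, h1, h2⟩ := hH
  have hHi : Integrable H μ11 := hm.integrable hp
  obtain ⟨M, hM⟩ : ∃ M : ℕ, ∀ k : ℕ, M ≤ k → t ⊆ Finset.Icc (-(k:ℤ)) (k:ℤ) := by
    refine ⟨t.sup Int.natAbs, fun k hk n hn => ?_⟩
    have := Finset.le_sup (f := Int.natAbs) hn
    rw [Finset.mem_Icc]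
    omega
  set A := ∑ n ∈ t, al n * Ph u (lam n) with hA
  set W := ∫ s, (‖u s 0‖ ^ 2 + ‖u s 1‖ ^ 2) ∂μ01 with hW
  have hSi : ∀ k : ℕ, Integrable (fun s => ∑ n ∈ Finset.Icc (-(k:ℤ)) (k:ℤ), Dn lam al n s) μ11 :=
    fun k => integrable_finsetSum _ fun n _ => Dn_integrable lam al n
  rcases hp.eq_or_lt with rfl | hp1
  · have h3 := h2 rfl
    have hsum : ∀ N : ℕ, Bf (fun s => (N : ℂ)⁻¹ • ∑ k ∈ Finset.Icc 1 N,
        ∑ n ∈ Finset.Icc (-(k:ℤ)) (k:ℤ), Dn lam al n s) u = (N : ℂ)⁻¹ * ∑ k ∈ Finset.Icc 1 N,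
        Bf (fun s => ∑ n ∈ Finset.Icc (-(k:ℤ)) (k:ℤ), Dn lam al n s) u := by
      intro N
      rw [Bf_smul, Bf_sum _ hSi hu]
    have h4 := Bf_tendsto hu (G := fun N s => (N : ℂ)⁻¹ • ∑ k ∈ Finset.Icc 1 N,
        ∑ n ∈ Finset.Icc (-(k:ℤ)) (k:ℤ), Dn lam al n s)
      (fun N => (integrable_finsetSum _ fun k _ => hSi k).smul ((N : ℂ)⁻¹)) hHi h3
    simp only [hsum] at h4
    have h5 := ((Complex.continuous_re.tendsto _).comp h4).const_add W
    have h6 : Tendsto (fun N : ℕ => A - (M * A) * (N : ℝ)⁻¹) atTop (nhds A) := by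
      have := (tendsto_inv_atTop_nhds_zero_nat (𝕜 := ℝ)).const_mul (M * A)
      simpa using this.const_sub A
    refine le_of_tendsto_of_tendsto h6 h5 ?_
    filter_upwards [eventually_ge_atTop (M + 1)] with N hN
    have hN0 : (0:ℝ) < N := by exact_mod_cast (by omega : 0 < N)
    set S : ℕ → ℝ := fun k =>
      W + (Bf (fun s => ∑ n ∈ Finset.Icc (-(k:ℤ)) (k:ℤ), Dn lam al n s) u).re with hS
    have hS0 : ∀ k, 0 ≤ S k := fun k => by
      simpa using partial_lower (lam := lam) hpos hu (Finset.empty_subset (Finset.Icc (-(k:ℤ)) (k:ℤ)))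
    have hSA : ∀ k, M ≤ k → A ≤ S k := fun k hk => partial_lower hpos hu (hM k hk)
    have hre : ((N : ℂ)⁻¹ * ∑ k ∈ Finset.Icc 1 N,
        Bf (fun s => ∑ n ∈ Finset.Icc (-(k:ℤ)) (k:ℤ), Dn lam al n s) u).re =
        (N : ℝ)⁻¹ * ∑ k ∈ Finset.Icc 1 N,
          (Bf (fun s => ∑ n ∈ Finset.Icc (-(k:ℤ)) (k:ℤ), Dn lam al n s) u).re := by
      rw [← Complex.re_sum, ← Complex.re_ofReal_mul]
      push_cast; rfl
    have hW2 : W + (N : ℝ)⁻¹ * ∑ k ∈ Finset.Icc 1 N,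
          (Bf (fun s => ∑ n ∈ Finset.Icc (-(k:ℤ)) (k:ℤ), Dn lam al n s) u).re =
        (N : ℝ)⁻¹ * ∑ k ∈ Finset.Icc 1 N, S k := by
      simp only [hS, Finset.sum_add_distrib, Finset.sum_const, Nat.card_Icc, nsmul_eq_mul]
      simp only [Nat.add_sub_cancel]
      field_simp
    have hlow : ((N : ℝ) - M) * A ≤ ∑ k ∈ Finset.Icc 1 N, S k := by
      calc ((N : ℝ) - M) * A = ∑ k ∈ Finset.Icc (M+1) N, A := by
            rw [Finset.sum_const, Nat.card_Icc, nsmul_eq_mul,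
              show N + 1 - (M + 1) = N - M by omega, Nat.cast_sub (by omega)]
        _ ≤ ∑ k ∈ Finset.Icc (M+1) N, S k := Finset.sum_le_sum fun k hk =>
            hSA k (by have := (Finset.mem_Icc.1 hk).1; omega)
        _ ≤ _ := Finset.sum_le_sum_of_subset_of_nonneg
            (Finset.Icc_subset_Icc (by omega) le_rfl) fun k _ _ => hS0 k
    simp only [Function.comp]
    rw [hre, hW2]
    calc A - M * A * (N : ℝ)⁻¹ = (N : ℝ)⁻¹ * (((N : ℝ) - M) * A) := by field_simp
      _ ≤ _ := by gcongr
  · have h3 := h1 hp1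
    have h4 : Tendsto (fun N : ℕ => eLpNorm (fun s : ℝ =>
        (∑ n ∈ Finset.Icc (-(N:ℤ)) (N:ℤ), Dn lam al n s) - H s) 1 μ11) atTop (nhds 0) := by
      have hc : μ11 univ ^ (1 / (1:ℝ≥0∞).toReal - 1 / p.toReal) ≠ ∞ := by
        refine ENNReal.rpow_ne_top_of_nonneg ?_ (measure_ne_top _ _)
        rcases eq_or_ne p ∞ with rfl | hpt
        · simp
        · have : 1 ≤ p.toReal := by
            simpa using ENNReal.toReal_mono hpt hp
          have : 1 / p.toReal ≤ 1 := by
            rw [div_le_one (by linarith)]; exact this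
          simpa using this
      have h5 := ENNReal.Tendsto.mul_const h3 (Or.inr hc)
      rw [zero_mul] at h5
      refine tendsto_of_tendsto_of_tendsto_of_le_of_le tendsto_const_nhds h5 (fun _ => bot_le)
        (fun N => ?_)
      exact eLpNorm_le_eLpNorm_mul_rpow_measure_univ hp ((hSi N).sub hHi).1
    have h5 := ((Complex.continuous_re.tendsto _).comp (Bf_tendsto hu hSi hHi h4)).const_add W
    refine ge_of_tendsto h5 ?_
    filter_upwards [eventually_ge_atTop M] with N hN
    exact partial_lower hpos hu (hM N hN)

/-- The operator `I + 𝓗`, `(𝓗u)(x) = ∫₀¹ H(x-s)u(s) ds`, is uniformly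
positive on `ℍ = L₂((0,1),ℂ²)`. -/
theorem statement13 (p : ℝ≥0∞) (hp : 1 ≤ p) (hp' : p ≠ ∞)
    (lam al : ℤ → ℝ) (hmono : StrictMono lam)
    (hla : LamAsymp p lam) (halpos : ∀ n : ℤ, 0 < al n) (hal : AlAsymp p al)
    (H : ℝ → M2) (hH : IsHSum p lam al H) :
    ∃ C > (0:ℝ), ∀ u : ℝ → Fin 2 → ℂ, MemLp u 2 μ01 →
      C * (∫ x in Set.Ioo (0:ℝ) 1, (‖u x 0‖ ^ 2 + ‖u x 1‖ ^ 2)) ≤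
      (∫ x in Set.Ioo (0:ℝ) 1,
        ip2 (u x + ∫ s in Set.Ioo (0:ℝ) 1, (H (x - s)).mulVec (u s)) (u x)).re := by
  obtain ⟨C, hC, hlow⟩ := lower_bound lam al hmono.injective (lam_tendsto hla) halpos
    (al_tendsto hal)
  refine ⟨C / 2, by positivity, fun u hu => ?_⟩
  have hHi : Integrable H μ11 := hH.1.integrable hp
  have hform := form_eq hHi hu
  have hlower := form_lower hp halpos hH hu
  have hii := uf_ug_int hu
  change C / 2 * (∫ x, (‖u x 0‖ ^ 2 + ‖u x 1‖ ^ 2) ∂μ01) ≤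
    (∫ x, ip2 (u x + ∫ s, (H (x - s)).mulVec (u s) ∂μ01) (u x) ∂μ01).re
  rw [hform, Complex.add_re, Complex.ofReal_re]
  set W := ∫ x, (‖u x 0‖ ^ 2 + ‖u x 1‖ ^ 2) ∂μ01 with hW
  have hf := hlow (uf u) (uf_memLp hu) (2 * (W + (Bf H u).re)) (fun t => by
    refine le_trans ?_ (mul_le_mul_of_nonneg_left (hlower t) (by norm_num : (0:ℝ) ≤ 2))
    rw [Finset.mul_sum]
    refine Finset.sum_le_sum fun n _ => ?_
    unfold Ph
    nlinarith [mul_nonneg (halpos n).le (sq_nonneg ‖Ft (ug u) (lam n)‖)])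
  have hg := hlow (ug u) (ug_memLp hu) (2 * (W + (Bf H u).re)) (fun t => by
    refine le_trans ?_ (mul_le_mul_of_nonneg_left (hlower t) (by norm_num : (0:ℝ) ≤ 2))
    rw [Finset.mul_sum]
    refine Finset.sum_le_sum fun n _ => ?_
    unfold Ph
    nlinarith [mul_nonneg (halpos n).le (sq_nonneg ‖Ft (uf u) (lam n)‖)])
  have : C * (2 * W) ≤ 4 * (W + (Bf H u).re) := by
    rw [← hii, mul_add]; linarith
  linarith
end
end
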